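/- arXiv:1509.05260 — 7 statements merged into one kernel-verified Lean document; each statement's English description precedes it below -/
import Mathlib

section
/- For every real number α ≥ 0, every real ε > 0, and every positive integer N, there exist positive integers u and v with u > v ≥ N, u − v odd, and |λ(u/v) − α| < ε, where λ(x) = x/4 + 1/(4x) − 1/2. -/
/-- For every real `α ≥ 0`, every `ε > 0` and every positive integer `N`,
there exist positive integers `u > v ≥ N` with `u − v` odd and `|λ(u/v) − α| < ε`,
where `λ(x) = x/4 + 1/(4x) − 1/2`. -/
theorem lambda_approx (α : ℝ) (hα : 0 ≤ α) (ε : ℝ) (hε : 0 < ε) (N : ℕ) (hN : 0 < N) :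
    ∃ u v : ℕ, v < u ∧ N ≤ v ∧ Odd (u - v) ∧
      |((u : ℝ) / v) / 4 + 1 / (4 * ((u : ℝ) / v)) - 1 / 2 - α| < ε := by
  obtain ⟨y, hy1, hy⟩ : ∃ y : ℝ, 1 ≤ y ∧ y / 4 + 1 / (4 * y) - 1 / 2 = α := by
    have hs := Real.sq_sqrt (show 0 ≤ α ^ 2 + α by positivity)
    have hs0 := Real.sqrt_nonneg (α ^ 2 + α)
    set s := Real.sqrt (α ^ 2 + α)
    refine ⟨1 + 2 * α + 2 * s, by linarith, ?_⟩
    have : 1 + 2 * α + 2 * s ≠ 0 := by positivity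
    field_simp
    nlinarith
  obtain ⟨M, hM⟩ := exists_nat_gt (1 / ε)
  obtain ⟨v, hv⟩ : ∃ v : ℕ, v = N + M := ⟨_, rfl⟩
  have hv0 : (0 : ℝ) < v := by
    have : 0 < v := by omega
    exact_mod_cast this
  have hvM : (M : ℝ) ≤ v := by
    have : M ≤ v := by omega
    exact_mod_cast this
  have hvε : 1 / (v : ℝ) < ε := by
    rw [div_lt_comm₀ hv0 hε]
    linarith
  have ht : 0 ≤ (y - 1) * v / 2 := by
    have : 0 ≤ y - 1 := by linarith
    positivity
  have h1 := Nat.floor_le ht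
  have h2 := Nat.lt_floor_add_one ((y - 1) * v / 2)
  set k := ⌊(y - 1) * v / 2⌋₊
  refine ⟨v + (2 * k + 1), v, by omega, by omega, ⟨k, by omega⟩, ?_⟩
  have hx1 : 1 ≤ ((v + (2 * k + 1) : ℕ) : ℝ) / v := by
    rw [le_div_iff₀ hv0]
    push_cast
    have : (0 : ℝ) ≤ k := Nat.cast_nonneg k
    linarith
  have hxy : |((v + (2 * k + 1) : ℕ) : ℝ) / v - y| ≤ 1 / v := by
    have : ((v + (2 * k + 1) : ℕ) : ℝ) / v - y
        = (v + (2 * k + 1) - y * v) / v := by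
      push_cast
      field_simp
    rw [this, abs_div, abs_of_pos hv0]
    gcongr
    rw [abs_le]
    constructor <;> linarith
  generalize ((v + (2 * k + 1) : ℕ) : ℝ) / v = x at hx1 hxy
  have hx0 : 0 < x := by linarith
  have hy0 : 0 < y := by linarith
  have key : x / 4 + 1 / (4 * x) - 1 / 2 - α = (x - y) * ((1 - 1 / (x * y)) / 4) := by
    rw [← hy]
    field_simp
    ring
  have hxy1 : 1 ≤ x * y := by nlinarith
  have h3 : 1 / (x * y) ≤ 1 := by
    rw [div_le_one (by positivity)]
    exact hxy1
  have h4 : 0 < 1 / (x * y) := by positivity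
  have h5 : |(1 - 1 / (x * y)) / 4| ≤ 1 := by
    rw [abs_le]
    constructor <;> linarith
  rw [key, abs_mul]
  calc |x - y| * |(1 - 1 / (x * y)) / 4| ≤ |x - y| * 1 := by gcongr
    _ < ε := by linarith
end

section
/- Let p be a prime number, let g ≥ 0 be an integer, and let e > 0 and w > 0 be integers. Given real numbers α > 0 and ε > 0, there exist positive integers r, d, u with d ≥ 3 such that, setting δ = e·d(d−1)/2 and Υ = (u(u−1)/2)·e·p^r + u·d·e·p^r + u·δ + 2(g−1)·u + w(u+d−2), the denominator (d−1)(2(g−1)+δ) + Υ is nonzero and | p^r(δ − e(d−1) − u·e) / ((d−1)(2(g−1)+δ) + Υ) − α | < ε. -/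
/-- Proposition `denseprop`: for a prime `p`, integers `g ≥ 0`, `e > 0`, `w > 0`,
and reals `α > 0`, `ε > 0`, there are positive integers `r`, `d ≥ 3`, `u` such that, with
`δ = e·d(d−1)/2` and `Υ = (u(u−1)/2)·e·p^r + u·d·e·p^r + u·δ + 2(g−1)·u + w(u+d−2)`,
the denominator `(d−1)(2(g−1)+δ) + Υ` is nonzero and
`| p^r(δ − e(d−1) − u·e) / ((d−1)(2(g−1)+δ) + Υ) − α | < ε`. -/
theorem dense_proposition (p : ℕ) (hp : p.Prime) (g : ℕ) (e w : ℕ)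
    (he : 0 < e) (hw : 0 < w) (α ε : ℝ) (hα : 0 < α) (hε : 0 < ε) :
    ∃ r d u : ℕ, 0 < r ∧ 3 ≤ d ∧ 0 < u ∧
      (let δ : ℝ := (e : ℝ) * d * ((d : ℝ) - 1) / 2
       let Υ : ℝ := ((u : ℝ) * ((u : ℝ) - 1) / 2) * e * (p : ℝ) ^ r
            + (u : ℝ) * d * e * (p : ℝ) ^ r + (u : ℝ) * δ
            + 2 * ((g : ℝ) - 1) * u + (w : ℝ) * ((u : ℝ) + (d : ℝ) - 2)
       ((d : ℝ) - 1) * (2 * ((g : ℝ) - 1) + δ) + Υ ≠ 0 ∧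
       |(p : ℝ) ^ r * (δ - (e : ℝ) * ((d : ℝ) - 1) - (u : ℝ) * e)
          / (((d : ℝ) - 1) * (2 * ((g : ℝ) - 1) + δ) + Υ) - α| < ε) := by
  obtain ⟨c, hc, hcα⟩ : ∃ c : ℝ, 0 < c ∧ c * c / 2 / (1 / 2 + c) = α := by
    refine ⟨α + Real.sqrt (α ^ 2 + α), by positivity, ?_⟩
    have h := Real.sq_sqrt (show 0 ≤ α ^ 2 + α by positivity)
    have h0 := Real.sqrt_nonneg (α ^ 2 + α)
    rw [div_eq_iff (by positivity)]
    nlinarith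
  have hp1 : (1 : ℝ) < p := by exact_mod_cast hp.one_lt
  have he' : (0 : ℝ) < e := by exact_mod_cast he
  have hx : Filter.Tendsto (fun n : ℕ => ((⌈c * (n : ℝ)⌉₊ : ℕ) : ℝ) / (n : ℝ))
      Filter.atTop (nhds c) :=
    (tendsto_nat_ceil_mul_div_atTop hc.le).comp tendsto_natCast_atTop_atTop
  have hy : Filter.Tendsto (fun n : ℕ => ((n : ℝ))⁻¹) Filter.atTop (nhds 0) :=
    tendsto_inv_atTop_nhds_zero_nat
  have hd : Filter.Tendsto (fun n : ℕ => ⌈c * (n : ℝ)⌉₊) Filter.atTop Filter.atTop :=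
    tendsto_nat_ceil_atTop.comp (tendsto_natCast_atTop_atTop.const_mul_atTop hc)
  have hlim := (((((hx.mul (hx.sub hy)).div_const 2).sub ((hx.sub hy).mul hy)).sub hy).div
    ((((tendsto_const_nhds (x := (1 : ℝ))).sub hy).div_const 2).add hx)
    (by simp only [sub_zero]; positivity))
  have hval : (c * (c - 0) / 2 - (c - 0) * 0 - 0) / ((1 - 0) / 2 + c) = α := by
    rw [← hcα]; simp
  rw [hval] at hlim
  have hnear := (Metric.tendsto_nhds.1 hlim) (ε / 2) (by positivity)
  obtain ⟨u, hu1, hu2, hu3⟩ :=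
    (hnear.and ((hd.eventually_ge_atTop 3).and (Filter.eventually_gt_atTop 0))).exists
  simp only [Pi.div_apply] at hu1
  generalize ⌈c * (u : ℝ)⌉₊ = d at hu1 hu2
  have hu : (1 : ℝ) ≤ u := by exact_mod_cast hu3
  have hdR : (3 : ℝ) ≤ d := by exact_mod_cast hu2
  obtain ⟨A, hA⟩ : ∃ A : ℝ, A = (e : ℝ) * d * ((d : ℝ) - 1) / 2 - (e : ℝ) * ((d : ℝ) - 1)
    - (u : ℝ) * e := ⟨_, rfl⟩
  obtain ⟨B, hB⟩ : ∃ B : ℝ, B = ((u : ℝ) * ((u : ℝ) - 1) / 2) * e + (u : ℝ) * d * e := ⟨_, rfl⟩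
  obtain ⟨C, hC⟩ : ∃ C : ℝ, C = ((d : ℝ) - 1) * (2 * ((g : ℝ) - 1) + (e : ℝ) * d * ((d : ℝ) - 1) / 2)
    + (u : ℝ) * ((e : ℝ) * d * ((d : ℝ) - 1) / 2)
    + 2 * ((g : ℝ) - 1) * u + (w : ℝ) * ((u : ℝ) + (d : ℝ) - 2) := ⟨_, rfl⟩
  have hBpos : 0 < B := by
    have h1 : 0 ≤ (u : ℝ) - 1 := by linarith
    rw [hB]; positivity
  have hAB : |A / B - α| < ε / 2 := by
    rw [Real.dist_eq] at hu1
    convert hu1 using 3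
    have h1 : A = ((e : ℝ) * u ^ 2) * ((d : ℝ) / u * ((d : ℝ) / u - (u : ℝ)⁻¹) / 2
        - ((d : ℝ) / u - (u : ℝ)⁻¹) * (u : ℝ)⁻¹ - (u : ℝ)⁻¹) := by
      rw [hA]; field_simp
    have h2 : B = ((e : ℝ) * u ^ 2) * ((1 - (u : ℝ)⁻¹) / 2 + (d : ℝ) / u) := by
      rw [hB]; field_simp
    rw [h1, h2, mul_div_mul_left _ _ (by positivity)]
  have hq : Filter.Tendsto (fun r : ℕ => (p : ℝ) ^ r) Filter.atTop Filter.atTop :=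
    tendsto_pow_atTop_atTop_of_one_lt hp1
  have hden : Filter.Tendsto (fun r : ℕ => B + C / (p : ℝ) ^ r) Filter.atTop (nhds B) := by
    simpa using (tendsto_const_nhds (x := B)).add (hq.const_div_atTop C)
  have hl2 := (tendsto_const_nhds (x := A)).div hden hBpos.ne'
  obtain ⟨r, hr1, hr2, hr3⟩ := (((Metric.tendsto_nhds.1 hl2) (ε / 2) (by positivity)).and
    ((hden.eventually (lt_mem_nhds hBpos)).and (Filter.eventually_gt_atTop 0))).exists
  have hqpos : (0 : ℝ) < (p : ℝ) ^ r := by positivity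
  have hD : ((d : ℝ) - 1) * (2 * ((g : ℝ) - 1) + (e : ℝ) * d * ((d : ℝ) - 1) / 2)
      + (((u : ℝ) * ((u : ℝ) - 1) / 2) * e * (p : ℝ) ^ r
            + (u : ℝ) * d * e * (p : ℝ) ^ r + (u : ℝ) * ((e : ℝ) * d * ((d : ℝ) - 1) / 2)
            + 2 * ((g : ℝ) - 1) * u + (w : ℝ) * ((u : ℝ) + (d : ℝ) - 2))
      = (p : ℝ) ^ r * (B + C / (p : ℝ) ^ r) := by
    rw [mul_add _ B, mul_div_cancel₀ _ hqpos.ne', hB, hC]; ring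
  refine ⟨r, d, u, hr3, hu2, hu3, ?_⟩
  dsimp only
  rw [hD, ← hA, mul_div_mul_left _ _ hqpos.ne']
  refine ⟨(mul_pos hqpos hr2).ne', ?_⟩
  have h3 : |A / (B + C / (p : ℝ) ^ r) - A / B| < ε / 2 := by
    simpa [Real.dist_eq] using hr1
  rw [abs_lt] at *
  constructor <;> linarith [h3.1, h3.2, hAB.1, hAB.2]
end

section
/- Let p be a prime number. Given real numbers α > 0 and ε > 0, there exist positive integers e, r, l with l ≥ 3 such that the denominator (2l−2)(e·l(2l−1) − 2) + l·e·p^r is positive and | p^r·l·e·(2l−5) / ((2l−2)(e·l(2l−1) − 2) + l·e·p^r) − α | < ε. -/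
/-- Proposition `limit`: for a prime `p` and reals `α > 0`, `ε > 0`, there are
positive integers `e`, `r`, `l` with `l ≥ 3` such that the denominator
`(2l−2)(e·l(2l−1) − 2) + l·e·p^r` is positive and
`| p^r·l·e·(2l−5) / ((2l−2)(e·l(2l−1) − 2) + l·e·p^r) − α | < ε`. -/
theorem limit_proposition (p : ℕ) (hp : p.Prime) (α ε : ℝ) (hα : 0 < α) (hε : 0 < ε) :
    ∃ e r l : ℕ, 0 < e ∧ 0 < r ∧ 3 ≤ l ∧
      0 < (2 * (l : ℝ) - 2) * ((e : ℝ) * l * (2 * (l : ℝ) - 1) - 2)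
          + (l : ℝ) * e * (p : ℝ) ^ r ∧
      |(p : ℝ) ^ r * l * e * (2 * (l : ℝ) - 5)
          / ((2 * (l : ℝ) - 2) * ((e : ℝ) * l * (2 * (l : ℝ) - 1) - 2)
              + (l : ℝ) * e * (p : ℝ) ^ r) - α| < ε := by
  have hp1 : (1 : ℝ) < p := by exact_mod_cast hp.one_lt
  have ha : (0 : ℝ) < 1 / (2 * α) := by positivity
  have hq : Filter.Tendsto (fun n : ℕ => (p : ℝ) ^ n) Filter.atTop Filter.atTop :=
    tendsto_pow_atTop_atTop_of_one_lt hp1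
  have hu : Filter.Tendsto
      (fun n : ℕ => ((⌈1 / (2 * α) * (p : ℝ) ^ n⌉₊ : ℕ) : ℝ) / (p : ℝ) ^ n)
      Filter.atTop (nhds (1 / (2 * α))) :=
    (tendsto_nat_ceil_mul_div_atTop ha.le).comp hq
  have hv : Filter.Tendsto (fun n : ℕ => ((p : ℝ) ^ n)⁻¹) Filter.atTop (nhds 0) :=
    tendsto_inv_atTop_zero.comp hq
  have hl : Filter.Tendsto (fun n : ℕ => ⌈1 / (2 * α) * (p : ℝ) ^ n⌉₊)
      Filter.atTop Filter.atTop :=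
    tendsto_nat_ceil_atTop.comp (hq.const_mul_atTop ha)
  have hc : ContinuousAt (fun x : ℝ × ℝ => (2 * x.1 - 5 * x.2) /
      ((2 * x.1 - 2 * x.2) * (2 * x.1 - x.2 - 2 * x.2 ^ 2 / x.1) + x.2))
      (1 / (2 * α), 0) := by
    apply ContinuousAt.div
    · fun_prop
    · have : ContinuousAt (fun x : ℝ × ℝ => 2 * x.2 ^ 2 / x.1) (1 / (2 * α), 0) := by
        apply ContinuousAt.div
        · fun_prop
        · fun_prop
        · exact ha.ne'
      fun_prop
    · simp [hα.ne']
  have hlim := hc.tendsto.comp (hu.prodMk_nhds hv)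
  have hval : (2 * (1 / (2 * α)) - 5 * 0) /
      ((2 * (1 / (2 * α)) - 2 * 0) * (2 * (1 / (2 * α)) - 0 - 2 * 0 ^ 2 / (1 / (2 * α))) + 0)
      = α := by
    field_simp
    simp [hα.ne']
  simp only [hval] at hlim
  have h1 := Metric.tendsto_nhds.1 hlim ε hε
  obtain ⟨n, h1, h3, hn⟩ :=
    (h1.and ((hl.eventually_ge_atTop 3).and (Filter.eventually_gt_atTop 0))).exists
  refine ⟨1, n, ⌈1 / (2 * α) * (p : ℝ) ^ n⌉₊, one_pos, hn, h3, ?_⟩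
  simp only [Function.comp, Real.dist_eq] at h1
  generalize ⌈1 / (2 * α) * (p : ℝ) ^ n⌉₊ = l at *
  have hq0 : 0 < (p : ℝ) ^ n := by positivity
  generalize (p : ℝ) ^ n = q at *
  have h3' : (3 : ℝ) ≤ l := by exact_mod_cast h3
  have hl0 : (0 : ℝ) < l := by linarith
  generalize (l : ℝ) = L at *
  have hD : 0 < (2 * L - 2) * (((1 : ℕ) : ℝ) * L * (2 * L - 1) - 2)
          + L * ((1 : ℕ) : ℝ) * q := by
    push_cast
    have : 0 < L * q := by positivity
    have : 0 ≤ (2 * L - 2) * (1 * L * (2 * L - 1) - 2) :=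
      mul_nonneg (by linarith) (by nlinarith)
    linarith
  refine ⟨hD, ?_⟩
  convert h1 using 3
  have e1 : 2 * (L / q) - 5 * q⁻¹ = (q * L * ((1 : ℕ) : ℝ) * (2 * L - 5)) / (q ^ 2 * L) := by
    push_cast; field_simp
  have e2 : (2 * (L / q) - 2 * q⁻¹) * (2 * (L / q) - q⁻¹ - 2 * q⁻¹ ^ 2 / (L / q)) + q⁻¹ =
      ((2 * L - 2) * (((1 : ℕ) : ℝ) * L * (2 * L - 1) - 2)
          + L * ((1 : ℕ) : ℝ) * q) / (q ^ 2 * L) := by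
    push_cast; field_simp
  rw [e1, e2, div_div_div_cancel_right₀ (by positivity)]
end

section
/- Let C > 0 be a real constant and let q ≥ 17 be a prime number. Then the cardinality of the bad set 𝓕 satisfies |𝓕| ≤ C·√q·(log q + 2·log 2). -/
/-- The "bad set" 𝓕 of Girstmair: integers `x` with `1 ≤ x ≤ q−1` lying in some
F-neighbourhood `|x − q·(c/d)| ≤ C·√q/d²` of a Farey point `q·c/d` with
`1 ≤ d ≤ √q`, `0 ≤ c ≤ d`, `gcd(c,d) = 1`. -/
def badSet (C : ℝ) (q : ℕ) : Set ℕ :=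
  {x : ℕ | 1 ≤ x ∧ x ≤ q - 1 ∧ ∃ c d : ℕ, 1 ≤ d ∧ (d : ℝ) ≤ Real.sqrt q ∧ c ≤ d ∧
    Nat.gcd c d = 1 ∧ |(x : ℝ) - (q : ℝ) * ((c : ℝ) / (d : ℝ))| ≤ C * Real.sqrt q / (d : ℝ) ^ 2}

lemma harm_succ_le (n : ℕ) (hn : 5 ≤ n) : ((harmonic n : ℚ) : ℝ) ≤ Real.log (2 * n) := by
  induction n, hn using Nat.le_induction with
  | base =>
    have h5 : ((harmonic 5 : ℚ) : ℝ) = 137 / 60 := by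
      simp only [harmonic, Finset.sum_range_succ, Finset.sum_range_zero]
      norm_num
    rw [h5, Real.le_log_iff_exp_le (by norm_num)]
    have h : Real.exp (137 / 60) ^ 60 ≤ (10 : ℝ) ^ 60 := by
      rw [← Real.exp_nat_mul]
      have : ((60 : ℕ) : ℝ) * (137 / 60) = (137 : ℕ) * 1 := by norm_num
      rw [this, Real.exp_nat_mul]
      calc Real.exp 1 ^ 137 ≤ (2.7182818286 : ℝ) ^ 137 := by
            gcongr
            exact Real.exp_one_lt_d9.le
        _ ≤ _ := by norm_num
    have := le_of_pow_le_pow_left₀ (by norm_num) (by norm_num) h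
    norm_num at this ⊢
    exact this
  | succ n hn ih =>
    rw [harmonic_succ]
    push_cast
    have hn0 : (0 : ℝ) < n := by
      have : 0 < n := by omega
      exact_mod_cast this
    have h1 := Real.one_sub_inv_le_log_of_pos (x := ((n : ℝ) + 1) / n) (by positivity)
    rw [Real.log_div (by positivity) (by positivity)] at h1
    have h2 : 1 - (((n : ℝ) + 1) / n)⁻¹ = ((n : ℝ) + 1)⁻¹ := by
      field_simp
      ring
    rw [Real.log_mul (by norm_num) (by positivity)] at ih ⊢
    linarith

lemma harm_sqrt_le (q : ℕ) (hq : 17 ≤ q) :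
    2 * ((harmonic (Nat.sqrt q) : ℚ) : ℝ) ≤ Real.log q + 2 * Real.log 2 := by
  have h4 : 4 ≤ Nat.sqrt q := by
    rw [Nat.le_sqrt]; omega
  have hq0 : (0 : ℝ) < q := by
    have : 0 < q := by omega
    exact_mod_cast this
  rcases Nat.lt_or_ge 4 (Nat.sqrt q) with h | h
  · have h1 := harm_succ_le _ h
    have hs : (0 : ℝ) < Nat.sqrt q := by
      have : 0 < Nat.sqrt q := by omega
      exact_mod_cast this
    rw [Real.log_mul (by norm_num) (by positivity)] at h1
    have h2 : Real.log ((Nat.sqrt q : ℝ) ^ 2) ≤ Real.log q := by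
      apply Real.log_le_log (by positivity)
      exact_mod_cast Nat.sqrt_le' q
    rw [Real.log_pow] at h2
    push_cast at h2
    linarith
  · have he : Nat.sqrt q = 4 := le_antisymm h h4
    rw [he]
    have h5 : ((harmonic 4 : ℚ) : ℝ) = 25 / 12 := by
      simp only [harmonic, Finset.sum_range_succ, Finset.sum_range_zero]
      norm_num
    rw [h5]
    have hl : Real.log 17 ≤ Real.log q := by
      apply Real.log_le_log (by norm_num)
      exact_mod_cast hq
    have h68 : Real.log 68 = Real.log 17 + 2 * Real.log 2 := by
      rw [show (68 : ℝ) = 17 * 2 ^ 2 by norm_num, Real.log_mul (by norm_num) (by norm_num),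
        Real.log_pow]
      norm_num
    have h6 : (25 / 6 : ℝ) ≤ Real.log 68 := by
      rw [Real.le_log_iff_exp_le (by norm_num)]
      have h : Real.exp (25 / 6) ^ 6 ≤ (68 : ℝ) ^ 6 := by
        rw [← Real.exp_nat_mul]
        have : ((6 : ℕ) : ℝ) * (25 / 6) = (25 : ℕ) * 1 := by norm_num
        rw [this, Real.exp_nat_mul]
        calc Real.exp 1 ^ 25 ≤ (2.7182818286 : ℝ) ^ 25 := by
              gcongr
              exact Real.exp_one_lt_d9.le
          _ ≤ _ := by norm_num
      exact le_of_pow_le_pow_left₀ (by norm_num) (by norm_num) h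
    linarith

/-- The residues `x` with `d x ≡ k (mod q)` for some `0 < |k| ≤ m`. -/
noncomputable def badPiece (q m d : ℕ) : Finset ℕ :=
  ((Finset.Icc (-(m : ℤ)) m).erase 0).image (fun k : ℤ => ((k : ZMod q) * (d : ZMod q)⁻¹).val)

lemma badPiece_card (q m d : ℕ) : (badPiece q m d).card ≤ 2 * m := by
  refine Finset.card_image_le.trans ?_
  rw [Finset.card_erase_of_mem (by simp)]
  simp only [Int.card_Icc]
  omega

lemma badSet_subset (C : ℝ) (q : ℕ) (hq : q.Prime) :
    badSet C q ⊆ ((Finset.range (Nat.sqrt q)).biUnion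
      (fun i => badPiece q ⌊C * Real.sqrt q / ((i + 1 : ℕ) : ℝ)⌋₊ (i + 1)) : Finset ℕ) := by
  rintro x ⟨hx1, hx2, c, d, hd1, hd, -, -, h⟩
  haveI : Fact q.Prime := ⟨hq⟩
  have hq2 := hq.two_le
  have hds : d ≤ Nat.sqrt q := by
    rw [Nat.le_sqrt']
    have := Real.le_sqrt' (y := (q : ℝ)) (x := d) (by exact_mod_cast hd1)
    exact_mod_cast this.1 hd
  have hdq : d < q := lt_of_le_of_lt hds (Nat.sqrt_lt_self (by omega))
  have hd0 : (0 : ℝ) < d := by exact_mod_cast hd1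
  have hdz : (d : ZMod q) ≠ 0 := by
    rw [Ne, ZMod.natCast_eq_zero_iff]
    exact fun hh => absurd (Nat.le_of_dvd hd1 hh) (by omega)
  have hxz : (x : ZMod q) ≠ 0 := by
    rw [Ne, ZMod.natCast_eq_zero_iff]
    exact fun hh => absurd (Nat.le_of_dvd hx1 hh) (by omega)
  have hk : (((d * x - q * c : ℤ)) : ZMod q) = d * x := by
    push_cast
    simp
  simp only [Finset.coe_biUnion, Set.mem_iUnion, Finset.mem_coe, Finset.mem_range]
  refine ⟨d - 1, by omega, ?_⟩
  rw [Nat.sub_add_cancel hd1]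
  unfold badPiece
  rw [Finset.mem_image]
  refine ⟨d * x - q * c, ?_, ?_⟩
  · rw [Finset.mem_erase, Finset.mem_Icc, ← abs_le]
    constructor
    · intro h0
      rw [h0] at hk
      exact mul_ne_zero hdz hxz (by simpa using hk.symm)
    · rw [Int.abs_eq_natAbs]
      norm_cast
      apply Nat.le_floor
      rw [Nat.cast_natAbs]
      push_cast
      have e : (d : ℝ) * x - q * c = d * (x - q * (c / d)) := by
        field_simp
      rw [e, abs_mul, abs_of_pos hd0]
      calc (d : ℝ) * _ ≤ d * (C * Real.sqrt q / (d : ℝ) ^ 2) := by gcongr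
        _ = _ := by field_simp
  · rw [hk, mul_right_comm, mul_inv_cancel₀ hdz, one_mul, ZMod.val_natCast_of_lt (by omega)]

/-- for a real `C > 0` and a prime `q ≥ 17`, the cardinality of the bad set
satisfies `|𝓕| ≤ C·√q·(log q + 2·log 2)`. -/
theorem badSet_card_le (C : ℝ) (hC : 0 < C) (q : ℕ) (hq : q.Prime) (hq17 : 17 ≤ q) :
    ((badSet C q).ncard : ℝ) ≤ C * Real.sqrt q * (Real.log q + 2 * Real.log 2) := by
  have h1 := Set.ncard_le_ncard (badSet_subset C q hq) (Finset.finite_toSet _)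
  rw [Set.ncard_coe_finset] at h1
  have h2 := h1.trans (Finset.card_biUnion_le.trans
    (Finset.sum_le_sum fun i _ => badPiece_card q _ (i + 1)))
  calc ((badSet C q).ncard : ℝ)
      ≤ ((∑ i ∈ Finset.range (Nat.sqrt q), 2 * ⌊C * Real.sqrt q / ((i + 1 : ℕ) : ℝ)⌋₊ : ℕ) : ℝ) := by
        exact_mod_cast h2
    _ ≤ ∑ i ∈ Finset.range (Nat.sqrt q), C * Real.sqrt q * 2 * ((i + 1 : ℕ) : ℝ)⁻¹ := by
        rw [Nat.cast_sum]
        apply Finset.sum_le_sum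
        intro i _
        have := Nat.floor_le (a := C * Real.sqrt q / ((i + 1 : ℕ) : ℝ)) (by positivity)
        rw [Nat.cast_mul]
        rw [div_eq_mul_inv] at this ⊢
        push_cast at this ⊢
        linarith
    _ = C * Real.sqrt q * (2 * ((harmonic (Nat.sqrt q) : ℚ) : ℝ)) := by
        rw [← Finset.mul_sum, harmonic]
        push_cast
        ring
    _ ≤ _ := by
        gcongr
        exact harm_sqrt_le q hq17
end

section
/- Let C > 0 be a real constant, let q ≥ 17 be a prime number, and let a be an integer with 1 ≤ a ≤ q−1 such that a does not belong to the bad set 𝓕. Then 12·|s(a,q)| ≤ (2 + 1/C)·√q + 5, where s(a,q) is the Dedekind sum. -/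
/-- The sawtooth function `((x)) = x − ⌊x⌋ − 1/2`. -/
noncomputable def sawtooth (x : ℝ) : ℝ := x - ⌊x⌋ - 1 / 2

/-- The Dedekind sum `s(a,q) = Σ_{i=1}^{q−1} ((i/q))·((ia/q))`. -/
noncomputable def dedekindSum (a q : ℕ) : ℝ :=
  ∑ i ∈ Finset.Icc 1 (q - 1), sawtooth ((i : ℝ) / q) * sawtooth ((i : ℝ) * a / q)

/-- Integer version of the Dedekind sum. -/
noncomputable def DD (h k : ℤ) : ℝ :=
  ∑ i ∈ Finset.Ico (1 : ℤ) k, ((i : ℝ) / k - 1 / 2) * ((((h * i) % k : ℤ) : ℝ) / k - 1 / 2)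

lemma mod_mem_aux (h h' k : ℤ) (hh : k ∣ h * h' - 1) (i : ℤ) (hi : i ∈ Finset.Ico (1 : ℤ) k) :
    (h * i) % k ∈ Finset.Ico (1 : ℤ) k := by
  rw [Finset.mem_Ico] at hi ⊢
  have hk : 0 < k := by omega
  have h1 := Int.emod_nonneg (h * i) hk.ne'
  have h2 := Int.emod_lt_of_pos (h * i) hk
  refine ⟨?_, h2⟩
  rcases h1.lt_or_eq with h3 | h3
  · omega
  · exfalso
    have h4 : k ∣ h * i := Int.dvd_of_emod_eq_zero h3.symm
    have h5 : k ∣ i := by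
      have : i = (h * i) * h' - (h * h' - 1) * i := by ring
      rw [this]
      exact dvd_sub (h4.mul_right _) (hh.mul_right _)
    have := Int.le_of_dvd (by omega) h5
    omega

lemma mod_inv_aux (h h' k : ℤ) (hh : k ∣ h * h' - 1) (i : ℤ) (hi : i ∈ Finset.Ico (1 : ℤ) k) :
    (h' * ((h * i) % k)) % k = i := by
  rw [Finset.mem_Ico] at hi
  have h1 : (h' * ((h * i) % k)) % k = i % k := by
    rw [Int.mul_emod, Int.emod_emod_of_dvd _ dvd_rfl, ← Int.mul_emod]
    apply Int.emod_emod_of_dvd _ dvd_rfl |>.symm.trans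
    rw [Int.emod_emod_of_dvd _ dvd_rfl]
    apply Int.emod_eq_emod_iff_emod_sub_eq_zero.2
    apply Int.emod_eq_zero_of_dvd
    have : h' * (h * i) - i = (h * h' - 1) * i := by ring
    rw [this]
    exact hh.mul_right _
  rw [h1, Int.emod_eq_of_lt (by omega) (by omega)]

lemma perm_sum (h h' k : ℤ) (hh : k ∣ h * h' - 1) (G : ℤ → ℤ → ℝ) :
    ∑ i ∈ Finset.Ico (1 : ℤ) k, G i ((h * i) % k) =
    ∑ i ∈ Finset.Ico (1 : ℤ) k, G ((h' * i) % k) i := by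
  have hh' : k ∣ h' * h - 1 := by rwa [mul_comm]
  refine Finset.sum_nbij' (fun i => (h * i) % k) (fun i => (h' * i) % k) ?_ ?_ ?_ ?_ ?_
  · exact fun i hi => mod_mem_aux h h' k hh i hi
  · exact fun i hi => mod_mem_aux h' h k hh' i hi
  · exact fun i hi => mod_inv_aux h h' k hh i hi
  · exact fun i hi => mod_inv_aux h' h k hh' i hi
  · intro i hi
    rw [mod_inv_aux h h' k hh i hi]

lemma DD_inv (h h' k : ℤ) (hh : k ∣ h * h' - 1) : DD h k = DD h' k := by
  unfold DD
  rw [perm_sum h h' k hh (fun x y => ((x : ℝ) / k - 1 / 2) * ((y : ℝ) / k - 1 / 2))]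
  exact Finset.sum_congr rfl fun i _ => mul_comm _ _

lemma DD_congr (h h' k : ℤ) (hh : k ∣ h - h') : DD h k = DD h' k := by
  unfold DD
  refine Finset.sum_congr rfl fun i _ => ?_
  have : (h * i) % k = (h' * i) % k := by
    apply Int.emod_eq_emod_iff_emod_sub_eq_zero.2
    apply Int.emod_eq_zero_of_dvd
    rw [← sub_mul]
    exact hh.mul_right _
  rw [this]

lemma exists_inv (h k : ℤ) (hc : IsCoprime h k) : ∃ h', k ∣ h * h' - 1 := by
  obtain ⟨x, y, hxy⟩ := hc
  exact ⟨x, -y, by linear_combination hxy⟩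

lemma DD_neg (h k : ℤ) (hc : IsCoprime h k) : DD (-h) k = - DD h k := by
  obtain ⟨h', hh⟩ := exists_inv h k hc
  unfold DD
  rw [← Finset.sum_neg_distrib]
  refine Finset.sum_congr rfl fun i hi => ?_
  have hm := mod_mem_aux h h' k hh i hi
  rw [Finset.mem_Ico] at hm
  have hk : 0 < k := by omega
  have : (-h * i) % k = k - (h * i) % k := by
    rw [← Int.emod_eq_of_lt (a := k - (h * i) % k) (b := k) (by omega) (by omega)]
    apply Int.emod_eq_emod_iff_emod_sub_eq_zero.2
    apply Int.emod_eq_zero_of_dvd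
    refine ⟨-(h * i / k) - 1, ?_⟩
    linear_combination Int.emod_add_mul_ediv (h * i) k
  rw [this]
  have hk' : (k : ℝ) ≠ 0 := by exact_mod_cast hk.ne'
  push_cast
  field_simp
  ring

lemma sum_one_aux (n : ℕ) : ∑ i ∈ Finset.Ico (1 : ℤ) (n + 1), (i : ℝ) = n * (n + 1) / 2 := by
  induction n with
  | zero => simp
  | succ n ih =>
    push_cast
    rw [← Finset.insert_Ico_right_eq_Ico_add_one (by omega), Finset.sum_insert (by simp), ih]
    push_cast
    ring

lemma sum_sq_aux (n : ℕ) :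
    ∑ i ∈ Finset.Ico (1 : ℤ) (n + 1), (i : ℝ) ^ 2 = n * (n + 1) * (2 * n + 1) / 6 := by
  induction n with
  | zero => simp
  | succ n ih =>
    push_cast
    rw [← Finset.insert_Ico_right_eq_Ico_add_one (by omega), Finset.sum_insert (by simp), ih]
    push_cast
    ring

lemma sum_one (k : ℤ) (hk : 0 < k) : ∑ i ∈ Finset.Ico (1 : ℤ) k, (i : ℝ) = (k - 1) * k / 2 := by
  obtain ⟨n, rfl⟩ : ∃ n : ℕ, k = n + 1 := ⟨(k - 1).toNat, by omega⟩
  rw [sum_one_aux]; push_cast; ring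

lemma sum_sq (k : ℤ) (hk : 0 < k) :
    ∑ i ∈ Finset.Ico (1 : ℤ) k, (i : ℝ) ^ 2 = (k - 1) * k * (2 * k - 1) / 6 := by
  obtain ⟨n, rfl⟩ : ∃ n : ℕ, k = n + 1 := ⟨(k - 1).toNat, by omega⟩
  rw [sum_sq_aux]; push_cast; ring

lemma sum_const_aux (k : ℤ) (hk : 0 < k) (c : ℝ) :
    ∑ _i ∈ Finset.Ico (1 : ℤ) k, c = (k - 1) * c := by
  rw [Finset.sum_const, Int.card_Ico, nsmul_eq_mul]
  congr 1
  have : ((k - 1).toNat : ℤ) = k - 1 := by omega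
  exact_mod_cast this

lemma DD_bound (h k : ℤ) (hk : 0 < k) (hc : IsCoprime h k) : 12 * |DD h k| ≤ k := by
  obtain ⟨h', hh⟩ := exists_inv h k hc
  have hk' : (0 : ℝ) < k := by exact_mod_cast hk
  have hS : ∑ i ∈ Finset.Ico (1 : ℤ) k, ((i : ℝ) / k - 1 / 2) ^ 2 =
      ((k : ℝ) - 1) * (k - 2) / (12 * k) := by
    have : ∀ i : ℤ, ((i : ℝ) / k - 1 / 2) ^ 2 =
        (1 / (k : ℝ) ^ 2) * (i : ℝ) ^ 2 - (1 / k) * i + 1 / 4 := by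
      intro i; field_simp; ring
    simp only [this, Finset.sum_add_distrib, Finset.sum_sub_distrib, ← Finset.mul_sum]
    rw [sum_sq k hk, sum_one k hk, sum_const_aux k hk]
    field_simp
    ring
  have hS2 := perm_sum h h' k hh (fun _ y => ((y : ℝ) / k - 1 / 2) ^ 2)
  rw [hS] at hS2
  have h1 : |DD h k| ≤ ((k : ℝ) - 1) * (k - 2) / (12 * k) := by
    unfold DD
    refine (Finset.abs_sum_le_sum_abs _ _).trans ?_
    have : ∀ i ∈ Finset.Ico (1 : ℤ) k,
        |((i : ℝ) / k - 1 / 2) * ((((h * i) % k : ℤ) : ℝ) / k - 1 / 2)| ≤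
        (1 / 2) * ((i : ℝ) / k - 1 / 2) ^ 2 +
        (1 / 2) * ((((h * i) % k : ℤ) : ℝ) / k - 1 / 2) ^ 2 := by
      intro i _
      rw [abs_le]
      constructor
      · nlinarith [sq_nonneg (((i : ℝ) / k - 1 / 2) + ((((h * i) % k : ℤ) : ℝ) / k - 1 / 2))]
      · nlinarith [sq_nonneg (((i : ℝ) / k - 1 / 2) - ((((h * i) % k : ℤ) : ℝ) / k - 1 / 2))]
    refine (Finset.sum_le_sum this).trans ?_
    rw [Finset.sum_add_distrib, ← Finset.mul_sum, ← Finset.mul_sum, hS, hS2]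
    linarith
  have h2 : 12 * (((k : ℝ) - 1) * (k - 2) / (12 * k)) ≤ k := by
    rw [mul_div_assoc', div_le_iff₀ (by positivity)]
    have : (1 : ℝ) ≤ k := by exact_mod_cast hk
    nlinarith
  linarith

lemma count_aux (h k : ℤ) (hh : 0 < h) (hk : 0 < k) (hc : IsCoprime h k) :
    ∑ i ∈ Finset.Ico (1 : ℤ) k, (((h * i / k : ℤ) : ℝ) * ((h * i / k : ℤ) + 1) / 2) =
    ∑ j ∈ Finset.Ico (1 : ℤ) h, (j : ℝ) * (k - 1 - (k * j / h : ℤ)) := by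
  have h1 : ∀ i ∈ Finset.Ico (1 : ℤ) k,
      ((h * i / k : ℤ) : ℝ) * ((h * i / k : ℤ) + 1) / 2 =
      ∑ j ∈ Finset.Ico (1 : ℤ) h, if k * j ≤ h * i then (j : ℝ) else 0 := by
    intro i hi
    rw [Finset.mem_Ico] at hi
    have hf0 : 0 ≤ h * i / k := Int.ediv_nonneg (by nlinarith) hk.le
    have hf1 : h * i / k < h := Int.ediv_lt_of_lt_mul hk (by nlinarith)
    have hset : (Finset.Ico (1 : ℤ) h).filter (fun j => k * j ≤ h * i) =
        Finset.Ico (1 : ℤ) (h * i / k + 1) := by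
      ext j
      simp only [Finset.mem_filter, Finset.mem_Ico]
      have : k * j ≤ h * i ↔ j ≤ h * i / k := by
        rw [Int.le_ediv_iff_mul_le hk, mul_comm]
      rw [this]
      omega
    rw [← Finset.sum_filter, hset, sum_one _ (by omega)]
    push_cast
    ring
  rw [Finset.sum_congr rfl h1, Finset.sum_comm]
  refine Finset.sum_congr rfl fun j hj => ?_
  rw [Finset.mem_Ico] at hj
  have hf0 : 0 ≤ k * j / h := Int.ediv_nonneg (by nlinarith) hh.le
  have hf1 : k * j / h < k := Int.ediv_lt_of_lt_mul hh (by nlinarith)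
  have hset : (Finset.Ico (1 : ℤ) k).filter (fun i => k * j ≤ h * i) =
      Finset.Ico (k * j / h + 1) k := by
    ext i
    simp only [Finset.mem_filter, Finset.mem_Ico]
    have h3 : k * j < h * i ↔ k * j / h < i := by
      rw [Int.ediv_lt_iff_lt_mul hh, mul_comm h]
    have h4 : k * j ≠ h * i := by
      intro he
      have : h ∣ j := hc.dvd_of_dvd_mul_left ⟨i, he⟩
      have := Int.le_of_dvd (by omega) this
      omega
    have h5 : k * j ≤ h * i ↔ k * j / h < i := by
      rw [← h3]; exact ⟨fun h => lt_of_le_of_ne h h4, le_of_lt⟩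
    rw [h5]
    omega
  rw [← Finset.sum_filter, hset, Finset.sum_const, Int.card_Ico, nsmul_eq_mul, mul_comm]
  congr 1
  have : ((k - (k * j / h + 1)).toNat : ℤ) = k - 1 - k * j / h := by omega
  exact_mod_cast this

lemma DD_formula (h k : ℤ) (hk : 0 < k) (hc : IsCoprime h k) :
    DD h k = h * ((k - 1) * (2 * k - 1)) / (6 * k)
      - (∑ i ∈ Finset.Ico (1 : ℤ) k, (i : ℝ) * (h * i / k : ℤ)) / k - (k - 1) / 4 := by
  obtain ⟨h', hh⟩ := exists_inv h k hc
  have hk' : (0 : ℝ) < k := by exact_mod_cast hk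
  have hm := perm_sum h h' k hh (fun _ y => (y : ℝ))
  rw [sum_one k hk] at hm
  unfold DD
  have : ∀ i : ℤ, ((i : ℝ) / k - 1 / 2) * ((((h * i) % k : ℤ) : ℝ) / k - 1 / 2) =
      (h / (k : ℝ) ^ 2) * (i : ℝ) ^ 2 - (1 / k) * ((i : ℝ) * (h * i / k : ℤ))
       - (1 / (2 * k)) * i - (1 / (2 * k)) * ((h * i) % k : ℤ) + 1 / 4 := by
    intro i
    have e : (((h * i) % k : ℤ) : ℝ) = h * i - k * (h * i / k : ℤ) := by
      have := Int.emod_def (h * i) k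
      rw [this]; push_cast; ring
    rw [e]
    field_simp; ring
  simp only [this, Finset.sum_add_distrib, Finset.sum_sub_distrib, ← Finset.mul_sum]
  rw [sum_sq k hk, hm, sum_one k hk, sum_const_aux k hk]
  field_simp
  ring

lemma DD_recip (h k : ℤ) (hh : 0 < h) (hk : 0 < k) (hc : IsCoprime h k) :
    12 * DD h k + 12 * DD k h = ((h : ℝ) ^ 2 + k ^ 2 + 1) / (h * k) - 3 := by
  obtain ⟨h', hi⟩ := exists_inv h k hc
  have hk' : (0 : ℝ) < k := by exact_mod_cast hk
  have hh' : (0 : ℝ) < h := by exact_mod_cast hh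
  have e : ∀ i : ℤ, (((h * i) % k : ℤ) : ℝ) = h * i - k * (h * i / k : ℤ) := by
    intro i
    have := Int.emod_def (h * i) k
    rw [this]; push_cast; ring
  have hL := perm_sum h h' k hi (fun _ y => (y : ℝ))
  have hB := perm_sum h h' k hi (fun _ y => (y : ℝ) ^ 2)
  have hC := count_aux h k hh hk hc
  rw [DD_formula h k hk hc, DD_formula k h hh hc.symm]
  have e2 : ∀ i : ℤ, ((h : ℝ) * i - k * (h * i / k : ℤ)) ^ 2 =
    (h : ℝ) ^ 2 * (i : ℝ) ^ 2 - (2 * h * k) * ((i : ℝ) * (h * i / k : ℤ))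
      + (k : ℝ) ^ 2 * ((h * i / k : ℤ) : ℝ) ^ 2 := by intro i; ring
  have e3 : ∀ i : ℤ, (((h * i / k : ℤ) : ℝ) * ((h * i / k : ℤ) + 1) / 2) =
    (1 / 2) * ((h * i / k : ℤ) : ℝ) ^ 2 + (1 / 2) * ((h * i / k : ℤ) : ℝ) := by intro i; ring
  have e4 : ∀ j : ℤ, (j : ℝ) * (k - 1 - (k * j / h : ℤ)) =
    ((k : ℝ) - 1) * j - j * (k * j / h : ℤ) := by intro i; ring
  simp only [e, e2, Finset.sum_add_distrib, Finset.sum_sub_distrib, ← Finset.mul_sum] at hL hB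
  simp only [e3, e4, Finset.sum_add_distrib, Finset.sum_sub_distrib, ← Finset.mul_sum] at hC
  rw [sum_one k hk] at hL
  rw [sum_sq k hk] at hB
  rw [sum_one h hh] at hC
  generalize ∑ i ∈ Finset.Ico (1 : ℤ) k, ((h * i / k : ℤ) : ℝ) ^ 2 = B at *
  generalize ∑ i ∈ Finset.Ico (1 : ℤ) k, ((h * i / k : ℤ) : ℝ) = L at *
  generalize ∑ i ∈ Finset.Ico (1 : ℤ) k, (i : ℝ) * (h * i / k : ℤ) = A at *
  generalize ∑ i ∈ Finset.Ico (1 : ℤ) h, (i : ℝ) * (k * i / h : ℤ) = A' at *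
  have hL' : L = ((h : ℝ) - 1) * (k - 1) / 2 := by
    apply mul_left_cancel₀ hk'.ne'
    linear_combination -hL
  have hB' : B = ((1 - (h : ℝ) ^ 2) * ((k - 1) * k * (2 * k - 1) / 6) + 2 * h * k * A) / k ^ 2 := by
    rw [eq_div_iff (by positivity)]
    linear_combination hB
  have hA' : A' = (k - 1) * ((h - 1) * h / 2) - (1 / 2) * B - (1 / 2) * L := by
    linarith
  rw [hA', hB', hL']
  field_simp
  ring

lemma three_term (n : ℕ) : ∀ r : ℤ, r.toNat ≤ n → 0 < r → ∀ q d a c j p b : ℤ, 0 < q → 0 < d →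
    a * d - q * c = r → IsCoprime a q → IsCoprime c d → r * p = j * q + d → r * b = j * a + c →
    12 * DD a q - 12 * DD c d =
      ((q : ℝ) ^ 2 + d ^ 2 + r ^ 2) / (q * d * r) - 3 + 12 * DD j r := by
  induction n with
  | zero => intro r h1 h2; omega
  | succ n ih =>
    intro r hrn hr q d a c j p b hq hd hdet haq hcd hp hb
    -- det one case
    have base : ∀ q d a c : ℤ, 0 < q → 0 < d → a * d - q * c = 1 →
        12 * DD a q - 12 * DD c d = ((q : ℝ) ^ 2 + d ^ 2 + 1) / (q * d) - 3 := by
      intro q d a c hq hd hdet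
      have hdq : IsCoprime d q := ⟨a, -c, by linear_combination hdet⟩
      have h1 : DD a q = DD d q := DD_inv _ _ _ ⟨c, by linear_combination hdet⟩
      have h2 : DD c d = DD (-q) d := DD_inv _ _ _ ⟨-a, by linear_combination hdet⟩
      rw [h1, h2, DD_neg _ _ hdq.symm]
      have := DD_recip d q hd hq hdq
      rw [show (d : ℝ) * q = q * d by ring] at this
      linear_combination this
    rcases (show r = 1 ∨ 1 < r by omega) with h1 | h1
    · subst h1
      rw [base q d a c hq hd hdet]
      simp [DD]
    -- reduce j
    obtain ⟨m, t, hmt, hm0, hmr⟩ : ∃ m t : ℤ, j = m + r * t ∧ 0 ≤ m ∧ m < r :=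
      ⟨j % r, j / r, (Int.emod_add_mul_ediv j r).symm, Int.emod_nonneg _ hr.ne',
        Int.emod_lt_of_pos _ hr⟩
    rw [DD_congr j m r ⟨t, by linear_combination hmt⟩]
    have hp' : r * (p - t * q) = m * q + d := by rw [mul_sub, hp, hmt]; ring
    have hb' : r * (b - t * a) = m * a + c := by rw [mul_sub, hb, hmt]; ring
    generalize p - t * q = P at *
    generalize b - t * a = Q at *
    have hmr_co : IsCoprime m r := by
      obtain ⟨x, y, hxy⟩ := hcd
      exact ⟨-(x * a + y * q), x * Q + y * P, by linear_combination hxy + x * hb' + y * hp'⟩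
    have hm : 0 < m := by
      rcases hm0.lt_or_eq with h | h
      · exact h
      · exfalso
        rw [← h, isCoprime_zero_left] at hmr_co
        rcases Int.isUnit_iff.1 hmr_co with h | h <;> omega
    have hP : 0 < P := by
      have : 0 < r * P := by rw [hp']; positivity
      exact pos_of_mul_pos_right this hr.le |> fun h => h
    have hd1 : a * P - q * Q = 1 := by
      apply mul_left_cancel₀ hr.ne'
      linear_combination a * hp' - q * hb' + hdet
    have hd2 : Q * d - P * c = m := by
      apply mul_left_cancel₀ hr.ne'
      linear_combination d * hb' - c * hp' + m * hdet
    have hco : IsCoprime Q P := ⟨-q, a, by linear_combination hd1⟩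
    have E1 := base q P a Q hq hP hd1
    have E2 := ih m (by omega) hm P d Q c (-r) (-q) (-a) hP hd hd2 hco hcd
      (by linear_combination hp') (by linear_combination hb')
    rw [DD_neg r m hmr_co.symm] at E2
    have E3 := DD_recip m r hm hr hmr_co
    have key : ((q : ℝ) ^ 2 + P ^ 2 + 1) / (q * P) + ((P : ℝ) ^ 2 + d ^ 2 + m ^ 2) / (P * d * m)
        - ((m : ℝ) ^ 2 + r ^ 2 + 1) / (m * r) = ((q : ℝ) ^ 2 + d ^ 2 + r ^ 2) / (q * d * r) := by
      have q0 : (q : ℝ) ≠ 0 := by exact_mod_cast hq.ne'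
      have d0 : (d : ℝ) ≠ 0 := by exact_mod_cast hd.ne'
      have P0 : (P : ℝ) ≠ 0 := by exact_mod_cast hP.ne'
      have m0 : (m : ℝ) ≠ 0 := by exact_mod_cast hm.ne'
      have r0 : (r : ℝ) ≠ 0 := by exact_mod_cast hr.ne'
      have hpr : (d : ℝ) = r * P - m * q := by
        have : d = r * P - m * q := by linear_combination -hp'
        exact_mod_cast this
      field_simp
      rw [hpr]
      ring
    linear_combination E1 + E2 - E3 + key

lemma pos_case (q d a c : ℤ) (hq : 0 < q) (hd : 0 < d) (haq : IsCoprime a q) (hcd : IsCoprime c d)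
    (hr : 0 < a * d - q * c) :
    12 * |DD a q| ≤ d + (a * d - q * c) +
      |((q : ℝ) ^ 2 + d ^ 2 + (a * d - q * c) ^ 2) / (q * d * (a * d - q * c)) - 3| := by
  obtain ⟨x, y, hxy⟩ := haq
  have hp : (a * d - q * c) * x = -(x * c + y * d) * q + d := by linear_combination d * hxy
  have hb : (a * d - q * c) * (-y) = -(x * c + y * d) * a + c := by linear_combination c * hxy
  have T := three_term _ (a * d - q * c) le_rfl hr q d a c _ _ _ hq hd rfl ⟨x, y, hxy⟩ hcd hp hb
  have hco : IsCoprime (-(x * c + y * d)) (a * d - q * c) := by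
    obtain ⟨u, v, huv⟩ := hcd
    exact ⟨-(u * a + v * q), u * (-y) + v * x, by linear_combination huv + u * hb + v * hp⟩
  have B1 := DD_bound _ _ hr hco
  have B2 := DD_bound _ _ hd hcd
  generalize DD (-(x * c + y * d)) (a * d - q * c) = X at *
  push_cast at T B1
  generalize ((q : ℝ) ^ 2 + d ^ 2 + (a * d - q * c) ^ 2) / (q * d * (a * d - q * c)) - 3 = Y at *
  have : 12 * |DD a q| = |12 * DD c d + Y + 12 * X| := by
    rw [← abs_of_pos (show (0 : ℝ) < 12 by norm_num), ← abs_mul,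
      abs_of_pos (show (0 : ℝ) < 12 by norm_num)]
    congr 1
    linear_combination T
  rw [this]
  have t1 := abs_add_le (12 * DD c d + Y) (12 * X)
  have t2 := abs_add_le (12 * DD c d) Y
  rw [abs_mul, abs_of_pos (show (0 : ℝ) < 12 by norm_num)] at t1 t2
  linarith

lemma final_case (C : ℝ) (hC : 0 < C) (q d a c : ℤ) (hq : 1 ≤ q) (hd : 0 < d)
    (haq : IsCoprime a q) (hcd : IsCoprime c d) (hr : 0 < a * d - q * c)
    (hd2 : (d : ℝ) ≤ √q) (hr2 : ((a * d - q * c : ℤ) : ℝ) ≤ √q)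
    (hr3 : C * √q < d * ((a * d - q * c : ℤ) : ℝ)) :
    12 * |DD a q| ≤ (2 + 1 / C) * √q + 5 := by
  have P := pos_case q d a c (by omega) hd haq hcd hr
  push_cast at hr2 hr3
  have hr' : (1 : ℝ) ≤ a * d - q * c := by exact_mod_cast hr
  generalize (a : ℝ) * d - q * c = r at *
  have hq' : (1 : ℝ) ≤ q := by exact_mod_cast hq
  have hd' : (1 : ℝ) ≤ d := by exact_mod_cast hd
  have hs : √(q : ℝ) ^ 2 = q := Real.sq_sqrt (by linarith)
  have hs1 : 1 ≤ √(q : ℝ) := Real.one_le_sqrt.2 hq'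
  generalize √(q : ℝ) = s at *
  have e : ((q : ℝ) ^ 2 + d ^ 2 + r ^ 2) / (q * d * r) = q / (d * r) + d / (q * r) + r / (q * d) := by
    field_simp
  have b1 : (q : ℝ) / (d * r) ≤ 1 / C * s := by
    rw [div_le_iff₀ (by positivity), ← hs]
    have : 1 / C * s * (C * s) ≤ 1 / C * s * (d * r) := by gcongr
    have e : 1 / C * s * (C * s) = s ^ 2 := by field_simp
    linarith
  have b2 : (d : ℝ) / (q * r) ≤ 1 := by
    rw [div_le_one (by positivity)]; nlinarith
  have b3 : r / (q * d) ≤ 1 := by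
    rw [div_le_one (by positivity)]; nlinarith
  have p1 : 0 < (q : ℝ) / (d * r) := by positivity
  have p2 : 0 < (d : ℝ) / (q * r) := by positivity
  have p3 : 0 < r / (q * d) := by positivity
  rw [e] at P
  have : |(q : ℝ) / (d * r) + d / (q * r) + r / (q * d) - 3| ≤ 1 / C * s + 5 := by
    rw [abs_le]; constructor <;> linarith
  linarith

lemma dedekind_eq (a q : ℕ) (hq : 0 < q) : dedekindSum a q = DD a q := by
  unfold dedekindSum DD
  refine Finset.sum_nbij' (fun i : ℕ => (i : ℤ)) (fun i => i.toNat) ?_ ?_ ?_ ?_ ?_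
  · intro i hi; simp only [Finset.mem_Icc, Finset.mem_Ico] at *; omega
  · intro i hi; simp only [Finset.mem_Icc, Finset.mem_Ico] at *; omega
  · intro i hi; simp
  · intro i hi; simp only [Finset.mem_Ico] at *; omega
  · intro i hi
    simp only [Finset.mem_Icc] at hi
    have hq' : (0 : ℝ) < q := by exact_mod_cast hq
    unfold sawtooth
    have f1 : ⌊(i : ℝ) / q⌋ = 0 := by
      rw [Int.floor_eq_zero_iff]
      refine ⟨by positivity, ?_⟩
      rw [div_lt_one hq']
      exact_mod_cast (by omega : i < q)
    have f2 : ⌊(i : ℝ) * a / q⌋ = ((a : ℤ) * i) / q := by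
      have := Nat.floor_div_eq_div (K := ℝ) (i * a) q
      have h2 := Int.natCast_floor_eq_floor (a := (i : ℝ) * a / q) (by positivity)
      push_cast at this
      rw [← h2, this]
      push_cast
      rw [mul_comm]
    rw [f1, f2, Int.emod_def]
    push_cast
    field_simp
    ring

/-- for a real `C > 0`, a prime `q ≥ 17`, and `1 ≤ a ≤ q−1` with `a ∉ 𝓕`,
the Dedekind sum satisfies `12·|s(a,q)| ≤ (2 + 1/C)·√q + 5`. -/
theorem dedekindSum_bound (C : ℝ) (hC : 0 < C) (q : ℕ) (hq : q.Prime) (hq17 : 17 ≤ q)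
    (a : ℕ) (ha1 : 1 ≤ a) (ha2 : a ≤ q - 1) (haF : a ∉ badSet C q) :
    12 * |dedekindSum a q| ≤ (2 + 1 / C) * Real.sqrt q + 5 := by
  rw [dedekind_eq a q (by omega)]
  have hqR : (0 : ℝ) < q := by exact_mod_cast (by omega : 0 < q)
  have haR : (1 : ℝ) ≤ a := by exact_mod_cast ha1
  have haqR : (a : ℝ) + 1 ≤ q := by exact_mod_cast (by omega : a + 1 ≤ q)
  have hcop : IsCoprime (a : ℤ) (q : ℤ) := by
    rw [Nat.isCoprime_iff_coprime]
    exact Nat.Coprime.symm ((Nat.Prime.coprime_iff_not_dvd hq).2 fun h => by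
      have := Nat.le_of_dvd (by omega) h
      omega)
  have hn : 0 < Nat.sqrt q := Nat.sqrt_pos.2 (by omega)
  obtain ⟨x, hx1, hx2⟩ := Real.exists_rat_abs_sub_le_and_den_le ((a : ℝ) / q) hn
  have hdpos : 0 < x.den := x.den_pos
  have hdR : (1 : ℝ) ≤ x.den := by exact_mod_cast hdpos
  have hxc : IsCoprime x.num (x.den : ℤ) := x.isCoprime_num_den
  have hxe : (x : ℝ) = (x.num : ℝ) / x.den := by exact_mod_cast (Rat.num_div_den x).symm
  generalize x.den = d at *
  generalize x.num = c at *
  rw [hxe] at hx1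
  have hs2 : √(q : ℝ) ^ 2 = q := Real.sq_sqrt hqR.le
  have hspos : 0 < √(q : ℝ) := Real.sqrt_pos.2 hqR
  have hsn : √(q : ℝ) < (Nat.sqrt q : ℝ) + 1 := by
    exact_mod_cast Real.sqrt_lt_sqrt hqR.le
      (show (q : ℝ) < ((Nat.sqrt q : ℝ) + 1) ^ 2 by exact_mod_cast Nat.lt_succ_sqrt' q) |>.trans_eq
      (Real.sqrt_sq (by positivity))
  have hds : (d : ℝ) ≤ √(q : ℝ) :=
    le_trans (by exact_mod_cast hx2) (Real.nat_sqrt_le_real_sqrt (a := q))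
  -- bound on r
  have hmul : |(a : ℝ) * d - q * c| = |(a : ℝ) / q - c / d| * (q * d) := by
    have e : (a : ℝ) * d - q * c = ((a : ℝ) / q - c / d) * (q * d) := by field_simp
    rw [e, abs_mul, abs_of_pos (show (0 : ℝ) < q * d by positivity)]
  have hr : |(a : ℝ) * d - q * c| < √(q : ℝ) := by
    rw [hmul]
    calc _ ≤ 1 / (((Nat.sqrt q : ℕ) + 1 : ℝ) * d) * (q * d) := by gcongr
      _ = q / ((Nat.sqrt q : ℝ) + 1) := by field_simp
      _ < √(q : ℝ) := by
        rw [div_lt_iff₀ (by positivity)]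
        nlinarith
  have hsq : √(q : ℝ) ≤ q := by
    have : 1 ≤ √(q : ℝ) := Real.one_le_sqrt.2 (by linarith)
    nlinarith
  rw [abs_lt] at hr
  have hc0 : 0 ≤ c := by
    by_contra h
    have : (c : ℝ) ≤ -1 := by exact_mod_cast (by omega : c ≤ -1)
    nlinarith
  have hcd : c ≤ d := by
    by_contra h
    have : (d : ℝ) + 1 ≤ c := by exact_mod_cast (by omega : (d : ℤ) + 1 ≤ c)
    nlinarith
  obtain ⟨c, rfl⟩ := Int.eq_ofNat_of_zero_le hc0
  have hbad : C * √(q : ℝ) < d * |(a : ℝ) * d - q * c| := by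
    by_contra hcon
    push Not at hcon
    apply haF
    refine ⟨ha1, ha2, c, d, hdpos, hds, by exact_mod_cast hcd, ?_, ?_⟩
    · exact Nat.isCoprime_iff_coprime.1 hxc
    · rw [le_div_iff₀ (by positivity)]
      have : |(a : ℝ) - q * (c / d)| * d ^ 2 = d * |(a : ℝ) * d - q * c| := by
        have e : (a : ℝ) * d - q * c = ((a : ℝ) - q * (c / d)) * d := by field_simp
        rw [e, abs_mul, abs_of_pos (show (0 : ℝ) < d by linarith)]
        ring
      rw [this]; exact hcon
  rw [Int.cast_natCast] at hr
  have hne : (a : ℤ) * d - q * c ≠ 0 := by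
    intro h
    have h' : (a : ℝ) * d - q * c = 0 := by exact_mod_cast h
    rw [h', abs_zero, mul_zero] at hbad
    have := mul_pos hC hspos
    linarith
  rcases lt_or_gt_of_ne hne with h | h
  · have hR : (a : ℝ) * d - q * c < 0 := by exact_mod_cast h
    rw [abs_of_neg hR] at hbad
    have F := final_case C hC q d (-a) (-c) (by omega) (by omega) hcop.neg_left hxc.neg_left
      (by linarith) (by exact_mod_cast hds) (by push_cast; linarith) (by push_cast; linarith)
    rw [DD_neg _ _ hcop, abs_neg] at F
    exact_mod_cast F
  · have hR : 0 < (a : ℝ) * d - q * c := by exact_mod_cast h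
    rw [abs_of_pos hR] at hbad
    have F := final_case C hC q d a c (by omega) (by omega) hcop hxc
      h (by exact_mod_cast hds) (by push_cast; linarith) (by push_cast; linarith)
    exact_mod_cast F
end

section
/- Let C > 0 be a real constant, let q ≥ 17 be a prime number, and let a be an integer with 1 ≤ a ≤ q−1 such that a does not belong to the bad set 𝓕. Suppose e₁, …, e_s are integers with e_i ≥ 2 for all i whose negative (Hirzebruch–Jung) continued fraction [e₁,…,e_s] equals q/a. Then s ≤ (2 + 1/C)·√q + 2. -/
/-- The negative (Hirzebruch–Jung) continued fraction `[e₁,…,e_s] = e₁ − 1/[e₂,…,e_s]`.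
(On the empty list it takes the junk value `0`; note that `1/0 = 0` in `ℚ`, so on a
singleton list `[e]` it correctly evaluates to `e`.) -/
def negCF : List ℚ → ℚ
  | [] => 0
  | e :: l => e - 1 / negCF l

/-- Convergent-type recursion with two initial values. -/
def seqR (e : ℕ → ℤ) (x y : ℤ) : ℕ → ℤ
  | 0 => x
  | 1 => y
  | (n + 2) => e n * seqR e x y (n + 1) - seqR e x y n

theorem negCF_gt_one (l : List ℚ) (hl : ∀ e ∈ l, 2 ≤ e) (hne : l ≠ []) : 1 < negCF l := by
  induction l with
  | nil => exact absurd rfl hne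
  | cons e l ih =>
    have he : 2 ≤ e := hl e (by simp)
    rcases List.eq_nil_or_concat l with h | ⟨_, _, h⟩
    · subst h
      simp only [negCF]
      norm_num
      linarith
    · have h1 : 1 < negCF l := ih (fun x hx => hl x (by simp [hx])) (by simp [h])
      have h2 : 1 / negCF l < 1 := by
        rw [div_lt_one (by linarith)]
        exact h1
      simp only [negCF]
      linarith

theorem card_le_of_inj (S : Finset ℕ) (f : ℕ → ℤ) (t : ℝ) (ht : 0 ≤ t)
    (hinj : ∀ i ∈ S, ∀ j ∈ S, i < j → f i ≠ f j)
    (hpos : ∀ i ∈ S, 1 ≤ f i) (hle : ∀ i ∈ S, (f i : ℝ) ≤ t) : (S.card : ℝ) ≤ t := by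
  have h : S.card ≤ (Finset.Icc (1 : ℤ) ⌊t⌋).card := by
    apply Finset.card_le_card_of_injOn f
    · intro i hi
      simp only [Finset.coe_Icc, Set.mem_Icc]
      exact ⟨hpos i hi, Int.le_floor.2 (hle i hi)⟩
    · intro i hi j hj hij
      rcases lt_trichotomy i j with h | h | h
      · exact absurd hij (hinj i hi j hj h)
      · exact h
      · exact absurd hij.symm (hinj j hj i hi h)
  rw [Int.card_Icc] at h
  have h0 : 0 ≤ ⌊t⌋ := Int.floor_nonneg.2 ht
  have h1 : (S.card : ℤ) ≤ ⌊t⌋ := by omega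
  have h2 : ((S.card : ℤ) : ℝ) ≤ (⌊t⌋ : ℝ) := by exact_mod_cast h1
  have := Int.floor_le t
  push_cast at h2
  linarith

theorem core_count (C t : ℝ) (hC : 0 < C) (ht : 0 < t) (s : ℕ) (e p r : ℕ → ℤ)
    (q : ℤ) (htq : t * t = q)
    (he : ∀ k, 2 ≤ e k)
    (p1 : p 1 = 1) (hpm : ∀ k, p k + 1 ≤ p (k + 1))
    (hp : ∀ k, p (k + 2) = e k * p (k + 1) - p k)
    (hr : ∀ k, r (k + 2) = e k * r (k + 1) - r k)
    (hrpos : ∀ k ≤ s, 0 < r k) (hrlt : ∀ k ≤ s, r (k + 1) < r k) 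
    (hdet : ∀ k, r k * p (k + 1) - r (k + 1) * p k = q)
    (hbad : ∀ k ≤ s, ((p (k + 1) - p k : ℤ) : ℝ) ≤ t →
      C * t < ((p (k + 1) - p k : ℤ) : ℝ) * ((r k - r (k + 1) : ℤ) : ℝ)) :
    (s : ℝ) ≤ (2 + 1 / C) * t := by
  have pmono : StrictMono p := strictMono_nat_of_lt_succ (fun k => by have := hpm k; omega)
  have rmono : ∀ j i, i + j ≤ s → r (i + j) + j ≤ r i := by
    intro j
    induction j with
    | zero => intro i _; simp
    | succ j ih =>
      intro i hi
      have h1 := ih i (by omega)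
      have h2 := hrlt (i + j) (by omega)
      push_cast
      rw [← add_assoc i j 1]
      omega
  have rmono' : ∀ i j, i ≤ j → j ≤ s → r j ≤ r i := by
    intro i j h1 h2
    have := rmono (j - i) i (by omega)
    rw [Nat.add_sub_cancel' h1] at this
    omega
  classical
  set A := (Finset.Icc 1 s).filter (fun k => (p k : ℝ) ≤ t) with hA
  set B := (Finset.Icc 1 s).filter (fun k => (r k : ℝ) ≤ t) with hB
  set M := (Finset.Icc 1 s).filter (fun k => t < (p k : ℝ) ∧ t < (r k : ℝ)) with hM
  have hcover : Finset.Icc 1 s ⊆ A ∪ B ∪ M := by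
    intro k hk
    simp only [hA, hB, hM, Finset.mem_union, Finset.mem_filter]
    by_cases h1 : (p k : ℝ) ≤ t
    · tauto
    by_cases h2 : (r k : ℝ) ≤ t
    · tauto
    push Not at h1 h2
    tauto
  have hcard : s ≤ A.card + B.card + M.card := by
    have h1 := Finset.card_le_card hcover
    have h2 := Finset.card_union_le (A ∪ B) M
    have h3 := Finset.card_union_le A B
    rw [Nat.card_Icc] at h1
    omega
  have hAc : (A.card : ℝ) ≤ t := by
    apply card_le_of_inj A p t ht.le
    · intro i _ j _ hij
      exact (pmono hij).ne
    · intro i hi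
      simp only [hA, Finset.mem_filter, Finset.mem_Icc] at hi
      rw [← p1]
      exact pmono.monotone hi.1.1
    · intro i hi
      simp only [hA, Finset.mem_filter] at hi
      exact hi.2
  have hBc : (B.card : ℝ) ≤ t := by
    apply card_le_of_inj B r t ht.le
    · intro i _ j hj hij
      simp only [hB, Finset.mem_filter, Finset.mem_Icc] at hj
      have := rmono (j - i) i (by omega)
      rw [Nat.add_sub_cancel' hij.le] at this
      omega
    · intro i hi
      simp only [hB, Finset.mem_filter, Finset.mem_Icc] at hi
      exact hrpos i hi.1.2
    · intro i hi
      simp only [hB, Finset.mem_filter] at hi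
      exact hi.2
  have hMc : (M.card : ℝ) ≤ t / C := by
    rcases M.eq_empty_or_nonempty with h | hne
    · rw [h]
      simp
      positivity
    -- facts about elements of M
    have key : ∀ k ∈ M, ((p (k + 1) - p k : ℤ) : ℝ) < t ∧ ((r k - r (k + 1) : ℤ) : ℝ) < t ∧
        ((p (k + 1) - p k : ℤ) : ℝ) * r k < t * t := by
      intro k hk
      simp only [hM, Finset.mem_filter, Finset.mem_Icc] at hk
      obtain ⟨⟨hk1, hk2⟩, hkp, hkr⟩ := hk
      have hd : (0 : ℝ) < ((p (k + 1) - p k : ℤ) : ℝ) := by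
        have := hpm k
        exact_mod_cast (by omega : 0 < p (k + 1) - p k)
      have hε : (0 : ℝ) < ((r k - r (k + 1) : ℤ) : ℝ) := by
        have := hrlt k hk2
        exact_mod_cast (by omega : 0 < r k - r (k + 1))
      have hq : ((r k - r (k + 1) : ℤ) : ℝ) * p k + ((p (k + 1) - p k : ℤ) : ℝ) * r k = t * t := by
        rw [htq, ← hdet k]
        push_cast
        ring
      refine ⟨?_, ?_, ?_⟩
      · by_contra! h
        nlinarith [mul_pos hε (ht.trans hkp), mul_pos hd (sub_pos.2 hkr)]
      · by_contra! h
        nlinarith [mul_pos hd (ht.trans hkr), mul_pos hε (sub_pos.2 hkp)]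
      · nlinarith [mul_pos hε (ht.trans hkp)]
    set k0 := M.min' hne with hk0
    set k1 := M.max' hne with hk1
    have hk0M : k0 ∈ M := M.min'_mem hne
    have hk1M : k1 ∈ M := M.max'_mem hne
    have hmid : ∀ k, k0 ≤ k → k ≤ k1 → k ∈ M := by
      intro k h1 h2
      have ha := hk0M
      have hb := hk1M
      simp only [hM, Finset.mem_filter, Finset.mem_Icc] at ha hb ⊢
      refine ⟨⟨by omega, by omega⟩, ?_, ?_⟩
      · have : (p k0 : ℝ) ≤ p k := by exact_mod_cast pmono.monotone h1
        linarith [ha.2.1]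
      · have : (r k1 : ℝ) ≤ r k := by exact_mod_cast rmono' k k1 h2 hb.1.2
        linarith [hb.2.2]
    have he2 : ∀ k, k + 1 ∈ M → e k = 2 := by
      intro k hk
      have h1 := (key _ hk).1
      simp only [hM, Finset.mem_filter, Finset.mem_Icc] at hk
      have h2 : ((p (k + 1 + 1) - p (k + 1) : ℤ) : ℝ) < p (k + 1) := lt_trans h1 hk.2.1
      have h3 : p (k + 2) - p (k + 1) < p (k + 1) := by exact_mod_cast h2
      rw [hp k] at h3
      have h4 := hpm k
      have h5 : 0 < p (k + 1) := by
        have : p 1 ≤ p (k + 1) := pmono.monotone (by omega)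
        omega
      by_contra h
      have h6 : 3 ≤ e k := by
        have := he k
        omega
      nlinarith
    have hconst : ∀ j, k0 + j ≤ k1 → r (k0 + j) - r (k0 + j + 1) = r k0 - r (k0 + 1) ∧
        r (k0 + j) = r k0 - j * (r k0 - r (k0 + 1)) := by
      intro j
      induction j with
      | zero => intro _; simp
      | succ j ih =>
        intro hj
        obtain ⟨h1, h2⟩ := ih (by omega)
        have h3 := he2 (k0 + j) (hmid _ (by omega) (by omega))
        have h4 := hr (k0 + j)
        rw [h3] at h4
        rw [← add_assoc k0 j 1]
        refine ⟨?_, ?_⟩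
        · rw [h4]; linarith
        · push_cast
          linarith
    have hk01 : k0 ≤ k1 := M.min'_le _ hk1M
    have hN : M.card ≤ k1 - k0 + 1 := by
      have : M ⊆ Finset.Icc k0 k1 := by
        intro k hk
        rw [Finset.mem_Icc]
        exact ⟨M.min'_le _ hk, M.le_max' _ hk⟩
      have := Finset.card_le_card this
      rw [Nat.card_Icc] at this
      omega
    obtain ⟨n, hn⟩ := Nat.exists_eq_add_of_le hk01
    obtain ⟨c1, c2⟩ := hconst n hn.ge
    rw [← hn] at c1 c2
    obtain ⟨a1, -, a3⟩ := key k0 hk0M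
    obtain ⟨-, b2, -⟩ := key k1 hk1M
    have ha := hk0M
    have hb := hk1M
    simp only [hM, Finset.mem_filter, Finset.mem_Icc] at ha hb
    have hbd := hbad k0 ha.1.2 a1.le
    rw [c1] at b2
    have c2' : (r k1 : ℝ) = r k0 - n * ((r k0 - r (k0 + 1) : ℤ) : ℝ) := by
      rw [c2]; push_cast; ring
    have hN' : (M.card : ℝ) ≤ n + 1 := by
      have : M.card ≤ n + 1 := by omega
      exact_mod_cast this
    have hd : (0 : ℝ) < ((p (k0 + 1) - p k0 : ℤ) : ℝ) := by
      have := hpm k0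
      exact_mod_cast (by omega : 0 < p (k0 + 1) - p k0)
    generalize ((p (k0 + 1) - p k0 : ℤ) : ℝ) = d at *
    generalize ((r k0 - r (k0 + 1) : ℤ) : ℝ) = ε at *
    have f1 : (n + 1) * ε < r k0 := by linarith [hb.2.2]
    have f2 : (n + 1) * (d * ε) < t * t := by nlinarith
    have f3 : (n + 1) * (C * t) < t * t := by
      have : (0 : ℝ) < n + 1 := by positivity
      nlinarith
    have f4 : (n + 1) * C < t := by
      by_contra! h
      nlinarith
    rw [le_div_iff₀ hC]
    nlinarith
  have h : (s : ℝ) ≤ A.card + B.card + M.card := by exact_mod_cast hcard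
  have : (2 + 1 / C) * t = t + t + t / C := by ring
  linarith

theorem length_bound (C : ℝ) (hC : 0 < C) (q : ℕ) (hq : q.Prime) (hq17 : 17 ≤ q)
    (a : ℕ) (ha1 : 1 ≤ a) (ha2 : a ≤ q - 1) (haF : a ∉ badSet C q)
    (E : List ℕ) (hE : ∀ e ∈ E, 2 ≤ e)
    (hcf : negCF (E.map (fun e => (e : ℚ))) = (q : ℚ) / (a : ℚ)) :
    (E.length : ℝ) ≤ (2 + 1 / C) * Real.sqrt q + 2 := by
  have hcf' : negCF (E.map (Nat.cast : ℕ → ℚ)) = (q : ℚ) / (a : ℚ) := by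
    rw [← hcf]
    congr 1
    simp [List.map_eq_flatMap, List.bind_eq_flatMap]
  have hq0 : (0 : ℝ) < q := by exact_mod_cast (by omega : 0 < q)
  have ht : 0 < Real.sqrt q := Real.sqrt_pos.2 hq0
  have htt : Real.sqrt q * Real.sqrt q = q := Real.mul_self_sqrt hq0.le
  set t := Real.sqrt q with htdef
  set e : ℕ → ℤ := fun k => ((E.getD k 2 : ℕ) : ℤ) with hedef
  have he : ∀ k, 2 ≤ e k := by
    intro k
    simp only [hedef]
    by_cases h : k < E.length
    · rw [List.getD_eq_getElem _ _ h]
      exact_mod_cast hE _ (List.getElem_mem h)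
    · rw [List.getD_eq_default _ _ (by omega)]
      norm_num
  set p := seqR e 0 1 with hpdef
  set c := seqR e (-1) 0 with hcdef
  set r := seqR e q a with hrdef
  have hp : ∀ k, p (k + 2) = e k * p (k + 1) - p k := fun k => rfl
  have hc : ∀ k, c (k + 2) = e k * c (k + 1) - c k := fun k => rfl
  have hr : ∀ k, r (k + 2) = e k * r (k + 1) - r k := fun k => rfl
  have p0 : p 0 = 0 := rfl
  have p1 : p 1 = 1 := rfl
  have c0 : c 0 = -1 := rfl
  have c1 : c 1 = 0 := rfl
  have r0 : r 0 = q := rfl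
  have r1 : r 1 = a := rfl
  have hrpc : ∀ k, r k = a * p k - q * c k ∧ r (k + 1) = a * p (k + 1) - q * c (k + 1) := by
    intro k
    induction k with
    | zero => simp [p0, p1, c0, c1, r0, r1]
    | succ k ih =>
      refine ⟨ih.2, ?_⟩
      rw [hr k, hp k, hc k, ih.1, ih.2]
      ring
  have hpc : ∀ k, 0 ≤ p k ∧ p k + 1 ≤ p (k + 1) := by
    intro k
    induction k with
    | zero => simp [p0, p1]
    | succ k ih =>
      have := he k
      refine ⟨by omega, ?_⟩
      rw [hp k]
      nlinarith
  have hcc : ∀ k, 0 ≤ c (k + 1) ∧ c k ≤ c (k + 1) := by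
    intro k
    induction k with
    | zero => simp [c0, c1]
    | succ k ih =>
      have := he k
      have h2 : c (k + 1) ≤ c (k + 1 + 1) := by
        rw [hc k]
        nlinarith
      exact ⟨by omega, h2⟩
  have hpmc : ∀ k, 0 ≤ p k - c k ∧ p k - c k ≤ p (k + 1) - c (k + 1) := by
    intro k
    induction k with
    | zero => simp [p0, p1, c0, c1]
    | succ k ih =>
      have := he k
      refine ⟨by omega, ?_⟩
      rw [hp k, hc k]
      nlinarith
  have hdetc : ∀ k, p k * c (k + 1) - p (k + 1) * c k = 1 := by
    intro k
    induction k with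
    | zero => simp [p0, p1, c0, c1]
    | succ k ih =>
      rw [hp k, hc k]
      linarith
  -- remainders
  have hrem : ∀ k ≤ E.length, 0 < r k ∧
      negCF ((E.drop k).map (Nat.cast : ℕ → ℚ)) = (r k : ℚ) / (r (k + 1) : ℚ) := by
    intro k
    induction k with
    | zero =>
      intro _
      refine ⟨by rw [r0]; omega, ?_⟩
      rw [r0, r1, List.drop_zero, hcf', Int.cast_natCast, Int.cast_natCast]
    | succ k ih =>
      intro hk
      obtain ⟨h1, h2⟩ := ih (by omega)
      have hgt : 1 < negCF ((E.drop k).map (Nat.cast : ℕ → ℚ)) := by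
        apply negCF_gt_one
        · intro x hx
          rw [List.mem_map] at hx
          obtain ⟨y, hy, rfl⟩ := hx
          exact_mod_cast hE y (List.mem_of_mem_drop hy)
        · intro h
          have := congrArg List.length h
          simp at this
          omega
      have h1' : (0 : ℚ) < r k := by exact_mod_cast h1
      have h3 : (0 : ℚ) < r (k + 1) := by
        by_contra! h
        rw [h2] at hgt
        have := div_nonpos_of_nonneg_of_nonpos h1'.le h
        linarith
      refine ⟨by exact_mod_cast h3, ?_⟩
      rw [List.drop_eq_getElem_cons (by omega : k < E.length), List.map_cons, negCF] at h2
      have hek : ((E[k] : ℕ) : ℚ) = (e k : ℚ) := by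
        simp only [hedef]
        rw [List.getD_eq_getElem _ _ (by omega : k < E.length)]
        norm_cast
      rw [hek] at h2
      have h4 : 1 / negCF ((E.drop (k + 1)).map (Nat.cast : ℕ → ℚ)) =
          (r (k + 1 + 1) : ℚ) / (r (k + 1) : ℚ) := by
        rw [hr k]
        push_cast
        rw [sub_div, mul_div_cancel_right₀ _ h3.ne']
        linarith
      rw [← one_div_one_div (negCF _), h4, one_div_div]
  have hrs : r (E.length + 1) = 0 := by
    obtain ⟨h1, h2⟩ := hrem E.length le_rfl
    rw [List.drop_length, List.map_nil, negCF] at h2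
    have h3 := div_eq_zero_iff.1 h2.symm
    rcases h3 with h3 | h3
    · have : r E.length = 0 := by exact_mod_cast h3
      omega
    · exact_mod_cast h3
  have hrlt : ∀ k ≤ E.length, r (k + 1) < r k := by
    intro k hk
    obtain ⟨h1, h2⟩ := hrem k hk
    rcases Nat.lt_or_ge k E.length with h | h
    · have hgt : 1 < negCF ((E.drop k).map (Nat.cast : ℕ → ℚ)) := by
        apply negCF_gt_one
        · intro x hx
          rw [List.mem_map] at hx
          obtain ⟨y, hy, rfl⟩ := hx
          exact_mod_cast hE y (List.mem_of_mem_drop hy)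
        · intro h
          have := congrArg List.length h
          simp at this
          omega
      have h3 : (0 : ℚ) < r (k + 1) := by exact_mod_cast (hrem (k + 1) h).1
      rw [h2, one_lt_div h3] at hgt
      exact_mod_cast hgt
    · have : k = E.length := by omega
      subst this
      omega
  have hfin : (E.length : ℝ) ≤ (2 + 1 / C) * t := by
    apply core_count C t hC ht E.length e p r (q : ℤ) (by rw [htt]; norm_cast) he p1
      (fun k => (hpc k).2) hp hr (fun k hk => (hrem k hk).1) hrlt
    · intro k
      rw [(hrpc k).1, (hrpc k).2]
      linear_combination (q : ℤ) * hdetc k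
    · intro k hk hdt
      by_contra! hcon
      apply haF
      have g1 : 0 < p (k + 1) - p k := by have := (hpc k).2; omega
      have g2 : 0 ≤ c (k + 1) - c k := by have := (hcc k).2; omega
      have g3 : c (k + 1) - c k ≤ p (k + 1) - p k := by have := (hpmc k).2; omega
      have g4 : IsCoprime (c (k + 1) - c k) (p (k + 1) - p k) :=
        ⟨p k, -c k, by linear_combination hdetc k⟩
      have g5 : (a : ℤ) * (p (k + 1) - p k) - q * (c (k + 1) - c k) = -(r k - r (k + 1)) := by
        rw [(hrpc k).1, (hrpc k).2]; ring
      have g6 : 0 < r k - r (k + 1) := by have := hrlt k hk; omega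
      generalize p (k + 1) - p k = d at *
      generalize c (k + 1) - c k = γ at *
      generalize r k - r (k + 1) = ε at *
      lift d to ℕ using g1.le
      lift γ to ℕ using g2
      have g1' : (0 : ℝ) < (d : ℝ) := by exact_mod_cast g1
      have g6' : (0 : ℝ) < (ε : ℝ) := by exact_mod_cast g6
      have g5' : (a : ℝ) * d - q * γ = -(ε : ℝ) := by exact_mod_cast g5
      refine ⟨ha1, ha2, γ, d, by omega, by exact_mod_cast hdt, by omega,
        Nat.isCoprime_iff_coprime.1 g4, ?_⟩
      have g7 : (a : ℝ) - q * ((γ : ℝ) / d) = -(ε / d) := by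
        field_simp
        linarith
      rw [g7, abs_neg, abs_of_pos (by positivity), div_le_div_iff₀ g1' (by positivity)]
      push_cast at hcon
      nlinarith
  linarith
end

section
/- Fix integers N ≥ 1, m ≥ 1, and n ≥ 1. Then there exists a real constant K such that for every positive integer q, the number of tuples of positive integers (x₁, …, x_m, y₁, …, y_n) satisfying N·(x₁ + ⋯ + x_m) + (y₁ + ⋯ + y_n) = q differs from q^{m+n−1} / ((m+n−1)! · N^m) by at most K·q^{m+n−2}. In particular, this number of solutions equals q^{m+n−1}/((m+n−1)!·N^m) + O(q^{m+n−2}) as q → ∞. -/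
/-- The set of positive integer solutions of a weighted linear equation. -/
def solSet {k : ℕ} (w : Fin k → ℕ) (q : ℕ) : Set (Fin k → ℕ) :=
  {z | (∀ i, 0 < z i) ∧ ∑ i, w i * z i = q}

lemma solSet_finite {k : ℕ} (w : Fin k → ℕ) (hw : ∀ i, 0 < w i) (q : ℕ) :
    (solSet w q).Finite := by
  apply Set.Finite.subset (Set.finite_Iic (fun _ : Fin k => q))
  rintro z ⟨_, h⟩ i
  calc z i ≤ w i * z i := Nat.le_mul_of_pos_left _ (hw i)
    _ ≤ ∑ i, w i * z i :=
      Finset.single_le_sum (f := fun i => w i * z i) (fun _ _ => Nat.zero_le _) (Finset.mem_univ i)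
    _ = q := h

lemma solSet_small {k : ℕ} (w : Fin (k+1) → ℕ) (q : ℕ) (hq : q < w 0) :
    (solSet w q).ncard = 0 := by
  have : solSet w q = ∅ := by
    ext z
    simp only [solSet, Set.mem_ofPred_eq, Set.mem_empty_iff_false, iff_false, not_and]
    intro hz h
    rw [Fin.sum_univ_succ] at h
    have := Nat.le_mul_of_pos_right (w 0) (hz 0)
    omega
  simp [this]

lemma solSet_rec {k : ℕ} (w : Fin (k+1) → ℕ) (hw : ∀ i, 0 < w i) (q : ℕ) :
    (solSet w (q + w 0)).ncard = (solSet w q).ncard + (solSet (Fin.tail w) q).ncard := by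
  have key : solSet w (q + w 0) =
      Set.image (fun z : Fin (k+1) → ℕ => (Fin.cons (z 0 + 1) (Fin.tail z) : Fin (k+1) → ℕ))
        (solSet w q) ∪
      Set.image (fun z : Fin k → ℕ => (Fin.cons 1 z : Fin (k+1) → ℕ))
        (solSet (Fin.tail w) q) := by
    ext z
    simp only [solSet, Set.mem_union, Set.mem_image, Set.mem_ofPred_eq]
    constructor
    · rintro ⟨hz, h⟩
      rw [Fin.sum_univ_succ] at h
      by_cases h1 : z 0 = 1
      · right
        refine ⟨Fin.tail z, ⟨fun i => hz _, ?_⟩, ?_⟩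
        · simp only [Fin.tail]
          rw [h1] at h
          omega
        · have h2 := Fin.cons_self_tail z
          rwa [h1] at h2
      · left
        have h0 := hz 0
        obtain ⟨t, ht⟩ : ∃ t, z 0 = t + 1 := ⟨z 0 - 1, by omega⟩
        refine ⟨Fin.cons t (Fin.tail z), ⟨?_, ?_⟩, ?_⟩
        · intro i
          refine Fin.cases ?_ (fun i => ?_) i
          · simp; omega
          · simpa [Fin.tail] using hz _
        · rw [Fin.sum_univ_succ]
          simp only [Fin.cons_zero, Fin.cons_succ, Fin.tail]
          rw [ht, mul_add] at h
          omega
        · simp only [Fin.cons_zero, Fin.tail_cons]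
          rw [← ht, Fin.cons_self_tail]
    · rintro (⟨y, ⟨hy, h⟩, rfl⟩ | ⟨y, ⟨hy, h⟩, rfl⟩)
      · constructor
        · intro i
          refine Fin.cases ?_ (fun i => ?_) i
          · simp
          · simpa [Fin.tail] using hy _
        · rw [Fin.sum_univ_succ] at h ⊢
          simp only [Fin.cons_zero, Fin.cons_succ, Fin.tail]
          rw [mul_add]
          omega
      · constructor
        · intro i
          refine Fin.cases ?_ (fun i => ?_) i
          · simp
          · simpa using hy _
        · rw [Fin.sum_univ_succ]
          simp only [Fin.cons_zero, Fin.cons_succ]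
          simp only [Fin.tail] at h
          omega
  rw [key, Set.ncard_union_eq ?_ ((solSet_finite w hw q).image _)
    ((solSet_finite (Fin.tail w) (fun i => hw _) q).image _), Set.ncard_image_of_injective, Set.ncard_image_of_injective]
  · intro a b hab
    exact (Fin.cons_inj.1 hab).2
  · intro a b hab
    have h := Fin.cons_inj.1 hab
    rw [← Fin.cons_self_tail a, ← Fin.cons_self_tail b, h.2]
    congr 1
    omega
  · rw [Set.disjoint_left]
    rintro _ ⟨a, ha, rfl⟩ ⟨b, hb, hab⟩
    have h := (Fin.cons_inj.1 hab).1
    have := ha.1 0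
    omega

lemma solSet_one (w : Fin 1 → ℕ) (h : w 0 = 1) (q : ℕ) :
    (solSet w q).ncard = if q = 0 then 0 else 1 := by
  split_ifs with hq
  · exact solSet_small w q (by omega)
  · have : solSet w q = {fun _ => q} := by
      ext z
      simp only [solSet, Set.mem_ofPred_eq, Set.mem_singleton_iff, Finset.univ_unique,
        Finset.sum_singleton, Fin.default_eq_zero, h, one_mul]
      constructor
      · rintro ⟨_, h2⟩
        ext i
        rw [Subsingleton.elim i 0, h2]
      · rintro rfl
        exact ⟨fun _ => Nat.pos_of_ne_zero hq, rfl⟩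
    simp [this]

/-- Upper bound for differences of powers. -/
lemma pow_diff_upper (x a : ℝ) (hx : 0 ≤ x) (ha : 0 ≤ a) (d : ℕ) :
    (x + a) ^ (d+1) - x ^ (d+1) ≤ (d + 1) * a * (x + a) ^ d := by
  induction d with
  | zero => simp
  | succ d ih =>
    have h1 : x ^ (d+1) ≤ (x+a)^(d+1) := by gcongr; linarith
    have h2 := mul_le_mul_of_nonneg_left ih (by positivity : 0 ≤ x + a)
    have h3 := mul_le_mul_of_nonneg_left h1 ha
    push_cast
    ring_nf at *
    nlinarith

/-- Lower bound for differences of powers. -/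
lemma pow_diff_lower (x a : ℝ) (hx : 0 ≤ x) (ha : 0 ≤ a) (d : ℕ) :
    (d + 1) * a * x ^ d ≤ (x + a) ^ (d+1) - x ^ (d+1) := by
  induction d with
  | zero => simp
  | succ d ih =>
    have h1 : x ^ (d+1) ≤ (x+a)^(d+1) := by gcongr; linarith
    have h2 := mul_le_mul_of_nonneg_left ih hx
    have h3 := mul_le_mul_of_nonneg_left h1 ha
    have e1 : (x + a) ^ (d+1+1) = x * (x+a)^(d+1) + a * (x+a)^(d+1) := by ring
    have e2 : x ^ (d+1+1) = x * x^(d+1) := by ring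
    have e3 : x * ((d + 1) * a * x ^ d) = (d+1) * a * x^(d+1) := by ring
    push_cast
    rw [e1, e2]
    linarith

/-- The inductive analytic step. -/
lemma step_bound (f g : ℕ → ℝ) (a d : ℕ) (ha : 0 < a) (c K : ℝ) (hc : 0 ≤ c) (hK : 0 ≤ K)
    (hf : ∀ q : ℕ, |f q - c * (q:ℝ) ^ (d+1)| ≤ K * (q:ℝ) ^ d)
    (hg0 : ∀ q < a, g q = 0) (hg : ∀ q, g (q + a) = g q + f q) (q : ℕ) :
    |g q - c / ((d + 2) * a) * (q:ℝ) ^ (d+2)| ≤ (K + c) * (q:ℝ) ^ (d+1) := by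
  have haR : (1:ℝ) ≤ a := by exact_mod_cast ha
  have hb : 0 ≤ c / ((d + 2) * a) := by positivity
  have hbc : c / ((d + 2) * a) * ((d + 2) * a) = c := by field_simp
  set b : ℝ := c / ((d + 2) * a) with hbdef
  clear_value b
  induction q using Nat.strong_induction_on with
  | _ q ih =>
    by_cases hq : q < a
    · rw [hg0 q hq, zero_sub, abs_neg, abs_of_nonneg (by positivity)]
      have hqa : (q:ℝ) ≤ (d+2) * a := by
        have : (q:ℝ) ≤ a := by exact_mod_cast hq.le
        nlinarith [(Nat.cast_nonneg d : (0:ℝ) ≤ d)]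
      calc b * (q:ℝ)^(d+2) = (b * q) * (q:ℝ)^(d+1) := by ring
        _ ≤ (b * ((d+2)*a)) * (q:ℝ)^(d+1) := by gcongr
        _ ≤ (K + c) * (q:ℝ)^(d+1) := by rw [hbc]; gcongr; linarith
    · obtain ⟨p, rfl⟩ : ∃ p, q = p + a := ⟨q - a, by omega⟩
      have h1 := ih p (by omega)
      have h2 := hf p
      have hp : (0:ℝ) ≤ p := Nat.cast_nonneg p
      have u := mul_le_mul_of_nonneg_left (pow_diff_upper p a hp (by linarith) (d+1)) hb
      have l := mul_le_mul_of_nonneg_left (pow_diff_lower p a hp (by linarith) (d+1)) hb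
      have l' := pow_diff_lower p a hp (by linarith) d
      have l2 : (p:ℝ)^d ≤ (p + a : ℝ)^(d+1) - (p:ℝ)^(d+1) := by
        refine le_trans ?_ l'
        have : 0 ≤ (p:ℝ)^d := by positivity
        have h1 : (1:ℝ) ≤ (d+1) * a := by nlinarith [(Nat.cast_nonneg d : (0:ℝ) ≤ d)]
        nlinarith
      have l3 := mul_le_mul_of_nonneg_left l2 hK
      have eu : b * (((d+1 : ℕ) + 1) * a * (p + a : ℝ)^(d+1)) = c * (p + a : ℝ)^(d+1) := by
        rw [← hbc]; push_cast; ring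
      have el : b * (((d+1 : ℕ) + 1) * a * (p : ℝ)^(d+1)) = c * (p : ℝ)^(d+1) := by
        rw [← hbc]; push_cast; ring
      rw [eu] at u
      rw [el] at l
      rw [hg]
      push_cast
      rw [abs_le] at *
      have e : d + 1 + 1 = d + 2 := rfl
      rw [e] at u l
      constructor <;> linarith [h1.1, h1.2, h2.1, h2.2]

lemma base_bound (f g : ℕ → ℝ) (a : ℕ) (ha : 0 < a)
    (hf : ∀ q : ℕ, f q = if q = 0 then 0 else 1)
    (hg0 : ∀ q < a, g q = 0) (hg : ∀ q, g (q + a) = g q + f q) (q : ℕ) :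
    |g q - 1 / a * (q:ℝ)| ≤ 1 := by
  have haR : (0:ℝ) < a := by exact_mod_cast ha
  induction q using Nat.strong_induction_on with
  | _ q ih =>
    by_cases hq : q < a
    · rw [hg0 q hq, zero_sub, abs_neg, abs_of_nonneg (by positivity), one_div_mul_eq_div,
        div_le_one haR]
      exact_mod_cast hq.le
    · obtain ⟨p, rfl⟩ : ∃ p, q = p + a := ⟨q - a, by omega⟩
      have h1 := ih p (by omega)
      have e : 1 / (a:ℝ) * ((p + a : ℕ) : ℝ) = 1 / a * p + 1 := by
        push_cast; field_simp
      rw [hg, hf, e]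
      by_cases hp : p = 0
      · subst hp
        simp [hg0 0 ha]
      · rw [if_neg hp]
        convert h1 using 2
        ring

lemma main_bound (k : ℕ) : ∀ (w : Fin (k+2) → ℕ), (∀ i, 0 < w i) → w (Fin.last _) = 1 →
    ∃ K : ℝ, 0 ≤ K ∧ ∀ q : ℕ,
      |((solSet w q).ncard : ℝ) -
        1 / (((k+1).factorial : ℝ) * ∏ i, (w i : ℝ)) * (q:ℝ)^(k+1)| ≤ K * (q:ℝ)^k := by
  induction k with
  | zero =>
    intro w hw hl
    refine ⟨1, zero_le_one, fun q => ?_⟩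
    have := base_bound (fun q => ((solSet (Fin.tail w) q).ncard : ℝ))
      (fun q => ((solSet w q).ncard : ℝ)) (w 0) (hw 0)
      (fun q => by simp only [solSet_one (Fin.tail w) hl q]; split_ifs <;> simp)
      (fun q hq => by simp [solSet_small w q hq])
      (fun q => by simp only [solSet_rec w hw q]; push_cast; rfl) q
    have h1 : w 1 = 1 := hl
    simpa [Fin.prod_univ_two, h1] using this
  | succ k ih =>
    intro w hw hl
    obtain ⟨K, hK, h⟩ := ih (Fin.tail w) (fun i => hw _) hl
    have hP : (0:ℝ) < ∏ i, (Fin.tail w i : ℝ) :=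
      Finset.prod_pos fun i _ => by exact_mod_cast hw _
    refine ⟨K + 1 / (((k+1).factorial : ℝ) * ∏ i, (Fin.tail w i : ℝ)), ?_, fun q => ?_⟩
    rotate_left
    · have := step_bound (fun q => ((solSet (Fin.tail w) q).ncard : ℝ))
        (fun q => ((solSet w q).ncard : ℝ)) (w 0) k (hw 0) _ K (by positivity) hK h
        (fun q hq => by simp [solSet_small w q hq])
        (fun q => by simp only [solSet_rec w hw q]; push_cast; rfl) q
      convert this using 4
      rw [Fin.prod_univ_succ, Nat.factorial_succ (k+1), div_div]
      congr 1
      simp only [Fin.tail]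
      push_cast
      ring
    · positivity

/-- for fixed positive integers `N`, `m`, `n`, the number of tuples of positive
integers `(x₁, …, x_m, y₁, …, y_n)` with `N·(x₁ + ⋯ + x_m) + (y₁ + ⋯ + y_n) = q` equals
`q^{m+n−1} / ((m+n−1)!·N^m) + O(q^{m+n−2})`: there is a constant `K` bounding the
difference by `K·q^{m+n−2}` for all positive `q`. -/
theorem count_solutions_asymptotic (N m n : ℕ) (hN : 1 ≤ N) (hm : 1 ≤ m) (hn : 1 ≤ n) :
    ∃ K : ℝ, ∀ q : ℕ, 0 < q →
      |(({xy : (Fin m → ℕ) × (Fin n → ℕ) |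
            (∀ i, 0 < xy.1 i) ∧ (∀ j, 0 < xy.2 j) ∧
            N * (∑ i, xy.1 i) + (∑ j, xy.2 j) = q}).ncard : ℝ)
          - (q : ℝ) ^ (m + n - 1) / ((Nat.factorial (m + n - 1) : ℝ) * (N : ℝ) ^ m)|
        ≤ K * (q : ℝ) ^ (m + n - 2) := by
  obtain ⟨m, rfl⟩ : ∃ t, m = t + 1 := ⟨m - 1, by omega⟩
  obtain ⟨n, rfl⟩ : ∃ t, n = t + 1 := ⟨n - 1, by omega⟩
  have gen : ∀ (s : ℕ) (_ : 2 ≤ s) (w : Fin s → ℕ), (∀ i, 0 < w i) →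
      (∀ i : Fin s, i.val + 1 = s → w i = 1) →
      ∃ K : ℝ, 0 ≤ K ∧ ∀ q : ℕ,
      |((solSet w q).ncard : ℝ) -
        1 / (((s-1).factorial : ℝ) * ∏ i, (w i : ℝ)) * (q:ℝ)^(s-1)| ≤ K * (q:ℝ)^(s-2) := by
    intro s hs
    obtain ⟨k, rfl⟩ : ∃ t, s = t + 2 := ⟨s - 2, by omega⟩
    intro w hw hl
    exact main_bound k w hw (hl _ (by simp))
  obtain ⟨K, -, hK⟩ := gen (m + 1 + (n + 1)) (by omega)
    (Fin.append (fun _ : Fin (m+1) => N) (fun _ : Fin (n+1) => 1))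
    (by
      intro i
      refine Fin.addCases (fun i => ?_) (fun i => ?_) i
      · simp; omega
      · simp)
    (by
      intro i
      refine Fin.addCases (fun i => ?_) (fun i => ?_) i
      · intro h
        have := i.isLt
        simp at h
        omega
      · simp)
  refine ⟨K, fun q _ => ?_⟩
  convert hK q using 3
  · congr 1
    rw [← Set.ncard_image_of_injective _ (Fin.appendEquiv (α := ℕ) (m+1) (n+1)).injective]
    congr 1
    ext z
    rw [Equiv.image_eq_preimage_symm]
    obtain ⟨xy, rfl⟩ := (Fin.appendEquiv (α := ℕ) (m+1) (n+1)).surjective z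
    simp only [Set.mem_preimage, Equiv.symm_apply_apply, Set.mem_ofPred_eq, solSet]
    simp only [Fin.appendEquiv, Equiv.coe_fn_mk]
    rw [Fin.sum_univ_add (a := m+1) (b := n+1), Finset.mul_sum]
    simp only [Fin.append_left, Fin.append_right, one_mul]
    rw [← and_assoc]
    refine and_congr_left fun _ => ?_
    constructor
    · rintro ⟨h1, h2⟩ i
      refine Fin.addCases (fun i => ?_) (fun i => ?_) i
      · simpa using h1 i
      · simpa using h2 i
    · intro h
      exact ⟨fun i => by simpa using h (Fin.castAdd _ i), fun i => by simpa using h (Fin.natAdd _ i)⟩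
  · rw [Fin.prod_univ_add (a := m+1) (b := n+1)]
    simp
    ring
end
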